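/- arXiv:1503.01149 — 4 statements merged into one kernel-verified Lean document; each statement's English description precedes it below -/
import Mathlib

section
/- Let K be an algebraically closed field of characteristic 0, let d ≥ 5 with d ≠ 6, and let α ∈ K^×. The automorphism group of the nonsingular plane curve defined by F = X^d + Y^{d−1}·Z + α·Y·Z^{d−1} is isomorphic to the group with presentation ⟨σ, τ ∣ σ² = τ^{d(d−2)} = 1, στσ = τ^{−(d−1)}⟩; in particular Aut(F) has order 2d(d−2), and it contains an element τ of order d(d−2) and an element σ of order 2 with στσ = τ^{−(d−1)}. -/
open MvPolynomial Matrix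

noncomputable section

variable {K : Type*} [Field K]

/-- The substitution `F ∘ A`, i.e. `X i ↦ ∑ j, A i j • X j`. -/
def substPoly (A : Matrix (Fin 3) (Fin 3) K) (F : MvPolynomial (Fin 3) K) :
    MvPolynomial (Fin 3) K :=
  aeval (fun i => ∑ j, A i j • X j) F

lemma substPoly_one (F : MvPolynomial (Fin 3) K) : substPoly 1 F = F := by
  have h : (fun i => ∑ j, (1 : Matrix (Fin 3) (Fin 3) K) i j • X j)
      = (X : Fin 3 → MvPolynomial (Fin 3) K) := by
    funext i
    simp [Matrix.one_apply, ite_smul]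
  rw [substPoly, h]
  exact aeval_X_left_apply F

lemma substPoly_smul (A : Matrix (Fin 3) (Fin 3) K) (c : K) (F : MvPolynomial (Fin 3) K) :
    substPoly A (c • F) = c • substPoly A F := by
  unfold substPoly
  exact _root_.map_smul (aeval fun i => ∑ j, A i j • X j) c F

lemma substPoly_mul (A B : Matrix (Fin 3) (Fin 3) K) (F : MvPolynomial (Fin 3) K) :
    substPoly (A * B) F = substPoly B (substPoly A F) := by
  have hfun : (fun i => ∑ j, (A * B) i j • (X j : MvPolynomial (Fin 3) K))
      = fun i => (aeval fun i => (∑ j, B i j • X j : MvPolynomial (Fin 3) K))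
          (∑ j, A i j • X j : MvPolynomial (Fin 3) K) := by
    funext i
    rw [map_sum]
    simp only [_root_.map_smul, aeval_X, Matrix.mul_apply, Finset.sum_smul, Finset.smul_sum, smul_smul]
    exact Finset.sum_comm
  have h1 : substPoly (A * B) F
      = aeval (fun i => (aeval fun i => (∑ j, B i j • X j : MvPolynomial (Fin 3) K))
          (∑ j, A i j • X j : MvPolynomial (Fin 3) K)) F := by
    unfold substPoly
    exact congrArg
      (fun f => (aeval f : MvPolynomial (Fin 3) K →ₐ[K] MvPolynomial (Fin 3) K) F) hfun
  rw [h1, ← MvPolynomial.comp_aeval]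
  rfl

/-- The subgroup of `GL₃(K)` preserving the polynomial `F` up to scalar. -/
def autGL (F : MvPolynomial (Fin 3) K) : Subgroup (GL (Fin 3) K) where
  carrier := {A | ∃ c : Kˣ, substPoly (A : Matrix (Fin 3) (Fin 3) K) F = (c : K) • F}
  one_mem' := ⟨1, by simp [substPoly_one]⟩
  mul_mem' := by
    rintro A B ⟨c, hc⟩ ⟨e, he⟩
    refine ⟨c * e, ?_⟩
    have hAB : ((A * B : GL (Fin 3) K) : Matrix (Fin 3) (Fin 3) K)
        = (A : Matrix (Fin 3) (Fin 3) K) * (B : Matrix (Fin 3) (Fin 3) K) := rfl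
    rw [hAB, substPoly_mul, hc, substPoly_smul, he, smul_smul, ← Units.val_mul]
  inv_mem' := by
    rintro A ⟨c, hc⟩
    refine ⟨c⁻¹, ?_⟩
    have key : (c : K) • substPoly ((A⁻¹ : GL (Fin 3) K) : Matrix (Fin 3) (Fin 3) K) F = F := by
      rw [← substPoly_smul, ← hc, ← substPoly_mul]
      have h1 : (A : Matrix (Fin 3) (Fin 3) K) *
          ((A⁻¹ : GL (Fin 3) K) : Matrix (Fin 3) (Fin 3) K) = 1 := by
        exact_mod_cast Units.mul_inv A
      rw [h1, substPoly_one]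
    calc substPoly ((A⁻¹ : GL (Fin 3) K) : Matrix (Fin 3) (Fin 3) K) F
        = ((c : K)⁻¹ * (c : K)) •
            substPoly ((A⁻¹ : GL (Fin 3) K) : Matrix (Fin 3) (Fin 3) K) F := by
          rw [inv_mul_cancel₀ (Units.ne_zero c), one_smul]
      _ = (c : K)⁻¹ • ((c : K) •
            substPoly ((A⁻¹ : GL (Fin 3) K) : Matrix (Fin 3) (Fin 3) K) F) := by
          rw [smul_smul]
      _ = (c : K)⁻¹ • F := by rw [key]
      _ = ((c⁻¹ : Kˣ) : K) • F := by rw [Units.val_inv_eq_inv_val]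

/-- `PGL₃(K)`: the quotient of `GL₃(K)` by its center (the scalar matrices). -/
abbrev PGL3 (K : Type*) [Field K] := GL (Fin 3) K ⧸ Subgroup.center (GL (Fin 3) K)

/-- The automorphism group of the plane curve `F = 0`, as a subgroup of `PGL₃(K)`:
the classes of matrices `A` with `F ∘ A = λ • F` for some `λ ∈ Kˣ`. -/
def projAut (F : MvPolynomial (Fin 3) K) : Subgroup (PGL3 K) :=
  (autGL F).map (QuotientGroup.mk' (Subgroup.center (GL (Fin 3) K)))

/-- `F` is nonsingular: the only common zero of its partial derivatives is the origin. -/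
def IsNonsingular (F : MvPolynomial (Fin 3) K) : Prop :=
  ∀ x : Fin 3 → K, (∀ i, eval x (pderiv i F) = 0) → x = 0

/-- `F` and `G` are projectively equivalent: `F ∘ A = λ • G` for some `A ∈ GL₃(K)`, `λ ∈ Kˣ`. -/
def ProjEquiv (F G : MvPolynomial (Fin 3) K) : Prop :=
  ∃ A : GL (Fin 3) K, ∃ c : Kˣ,
    substPoly (A : Matrix (Fin 3) (Fin 3) K) F = (c : K) • G


/-- The relations of the presentation `⟨σ, τ ∣ σ² = τ^(d(d-2)) = 1, στσ = τ^(-(d-1))⟩`,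
with `σ = FreeGroup.of true` and `τ = FreeGroup.of false`. -/
def rels4 (d : ℕ) : Set (FreeGroup Bool) :=
  {FreeGroup.of true ^ 2, FreeGroup.of false ^ (d * (d - 2)),
    FreeGroup.of true * FreeGroup.of false * FreeGroup.of true *
      FreeGroup.of false ^ (d - 1)}

section helpers

set_option linter.unusedSimpArgs false

/-- The polynomial function of the curve in degree `e + 5`. -/
def phi4 (e : ℕ) (α x y z : K) : K :=
  x ^ (e + 5) + y ^ (e + 4) * z + α * y * z ^ (e + 4)

lemma coeff_lin_pow (a b : K) (n k : ℕ) :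
    ((Polynomial.C a * Polynomial.X + Polynomial.C b) ^ n).coeff k
      = (n.choose k : K) * a ^ k * b ^ (n - k) := by
  rw [add_pow, Polynomial.finsetSum_coeff]
  have : ∀ i ∈ Finset.range (n + 1),
      ((Polynomial.C a * Polynomial.X) ^ i * (Polynomial.C b) ^ (n - i) *
        ((n.choose i : ℕ) : Polynomial K)).coeff k
      = if i = k then (n.choose k : K) * a ^ k * b ^ (n - k) else 0 := by
    intro i _
    have h : (Polynomial.C a * Polynomial.X) ^ i * (Polynomial.C b) ^ (n - i) *
        ((n.choose i : ℕ) : Polynomial K)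
        = Polynomial.C ((n.choose i : K) * a ^ i * b ^ (n - i)) * Polynomial.X ^ i := by
      simp only [Polynomial.C_mul, Polynomial.C_pow, mul_pow, map_natCast]
      ring
    rw [h, Polynomial.coeff_C_mul_X_pow]
    by_cases hik : i = k
    · subst hik; simp
    · simp [hik, Ne.symm hik]
  rw [Finset.sum_congr rfl this, Finset.sum_ite_eq']
  split_ifs with h
  · rfl
  · have : n < k := by simpa using h
    simp [Nat.choose_eq_zero_of_lt this]

lemma step1 [CharZero K] (e : ℕ) (α a b c l m n lam : K) (hα : α ≠ 0) (hlam : lam ≠ 0)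
    (hne : ¬ (l = 0 ∧ m = 0 ∧ n = 0))
    (h : ∀ x y z : K, a * ((e + 5) * x ^ (e + 4)) + b * ((e + 4) * y ^ (e + 3) * z + α * z ^ (e + 4))
      + c * (y ^ (e + 4) + (e + 4) * α * y * z ^ (e + 3))
      = lam * ((e + 5) * (l * x + m * y + n * z) ^ (e + 4))) :
    b = 0 ∧ c = 0 ∧ m = 0 ∧ n = 0 := by
  have h4 : (e + 4 : K) ≠ 0 := by exact_mod_cast (by omega : e + 4 ≠ 0)
  have h5 : (e + 5 : K) ≠ 0 := by exact_mod_cast (by omega : e + 5 ≠ 0)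
  have hlm : l = 0 ∨ m = 0 := by
    have hp : (Polynomial.C (a * (e + 5)) * Polynomial.X ^ (e + 4) + Polynomial.C c : Polynomial K)
        = Polynomial.C (lam * (e + 5)) * (Polynomial.C l * Polynomial.X + Polynomial.C m) ^ (e + 4) := by
      apply Polynomial.funext
      intro x
      have := h x 1 0
      simp at this ⊢
      linear_combination this
    have := congrArg (fun p => Polynomial.coeff p 1) hp
    simp only [Polynomial.coeff_add, Polynomial.coeff_C_mul, coeff_lin_pow] at this
    simp [Polynomial.coeff_X_pow, Polynomial.coeff_C, hlam, h4, h5] at this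
    exact this.imp id (fun h => h)
  have hln : l = 0 ∨ n = 0 := by
    have hp : (Polynomial.C (a * (e + 5)) * Polynomial.X ^ (e + 4) + Polynomial.C (b * α) : Polynomial K)
        = Polynomial.C (lam * (e + 5)) * (Polynomial.C l * Polynomial.X + Polynomial.C n) ^ (e + 4) := by
      apply Polynomial.funext
      intro x
      have := h x 0 1
      simp at this ⊢
      linear_combination this
    have := congrArg (fun p => Polynomial.coeff p 1) hp
    simp only [Polynomial.coeff_add, Polynomial.coeff_C_mul, coeff_lin_pow] at this
    simp [Polynomial.coeff_X_pow, Polynomial.coeff_C, hlam, h4, h5] at this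
    exact this.imp id (fun h => h)
  have hmn : m = 0 ∨ n = 0 := by
    have hp : (Polynomial.C (b * (e + 4)) * Polynomial.X ^ (e + 3) + Polynomial.C (b * α)
         + Polynomial.C c * Polynomial.X ^ (e + 4)
         + Polynomial.C (c * (e + 4) * α) * Polynomial.X : Polynomial K)
        = Polynomial.C (lam * (e + 5)) * (Polynomial.C m * Polynomial.X + Polynomial.C n) ^ (e + 4) := by
      apply Polynomial.funext
      intro x
      have := h 0 x 1
      simp at this ⊢
      linear_combination this
    have := congrArg (fun p => Polynomial.coeff p 2) hp
    have hc : ((e + 4).choose 2 : K) ≠ 0 := by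
      exact_mod_cast (Nat.choose_pos (by omega)).ne'
    simp only [Polynomial.coeff_add, Polynomial.coeff_C_mul, coeff_lin_pow] at this
    simp [Polynomial.coeff_X_pow, Polynomial.coeff_C, Polynomial.coeff_X,
      hlam, h4, h5, hc] at this
    exact this.imp id (fun h => h)
  by_cases hl : l = 0
  · exfalso
    subst hl
    rcases hmn with hm | hn
    · subst hm
      have e1 := h 0 1 0
      have e2 := h 0 0 1
      have e3 := h 0 1 1
      simp [h5] at e1 e2 e3
      subst e1
      simp at e3
      have : b * (e + 4) = 0 := by linear_combination e3 - e2
      have hb : b = 0 := by simpa [h4] using this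
      subst hb
      simp [hlam, h5] at e2
      simp [e2] at hne
    · subst hn
      have e1 := h 0 0 1
      have e2 := h 0 1 0
      have e3 := h 0 1 1
      simp [hα] at e1 e2 e3
      subst e1
      have : c * ((e + 4) * α) = 0 := by linear_combination e3 - e2
      have hc : c = 0 := by simpa [h4, hα] using this
      subst hc
      simp [hlam, h5] at e2
      simp [e2] at hne
  · have hm : m = 0 := by tauto
    have hn : n = 0 := by tauto
    subst hm hn
    have e1 := h 0 0 1
    have e2 := h 0 1 0
    simp [hα] at e1 e2
    exact ⟨e1, e2, rfl, rfl⟩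

lemma deriv_step [CharZero K] (e : ℕ) (α lam a₀ a₁ a₂ b₀ b₁ b₂ c₀ c₁ c₂ : K)
    (h : ∀ x y z : K, phi4 e α (a₀ * x + a₁ * y + a₂ * z) (b₀ * x + b₁ * y + b₂ * z)
      (c₀ * x + c₁ * y + c₂ * z) = lam * phi4 e α x y z) (x y z u v w : K)
    (hu : u = a₀ * x + a₁ * y + a₂ * z) (hv : v = b₀ * x + b₁ * y + b₂ * z)
    (hw : w = c₀ * x + c₁ * y + c₂ * z) :
    a₀ * ((e + 5) * u ^ (e + 4)) + b₀ * ((e + 4) * v ^ (e + 3) * w + α * w ^ (e + 4))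
      + c₀ * (v ^ (e + 4) + (e + 4) * α * v * w ^ (e + 3))
      = lam * ((e + 5) * x ^ (e + 4)) := by
  have hp : ((Polynomial.C u + Polynomial.C a₀ * Polynomial.X) ^ (e + 5)
      + (Polynomial.C v + Polynomial.C b₀ * Polynomial.X) ^ (e + 4)
        * (Polynomial.C w + Polynomial.C c₀ * Polynomial.X)
      + Polynomial.C α * (Polynomial.C v + Polynomial.C b₀ * Polynomial.X)
        * (Polynomial.C w + Polynomial.C c₀ * Polynomial.X) ^ (e + 4) : Polynomial K)
      = Polynomial.C lam * ((Polynomial.C x + Polynomial.X) ^ (e + 5)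
        + Polynomial.C (y ^ (e + 4) * z + α * y * z ^ (e + 4))) := by
    apply Polynomial.funext
    intro t
    have h1 := h (x + t) y z
    have e1 : a₀ * (x + t) + a₁ * y + a₂ * z = u + a₀ * t := by rw [hu]; ring
    have e2 : b₀ * (x + t) + b₁ * y + b₂ * z = v + b₀ * t := by rw [hv]; ring
    have e3 : c₀ * (x + t) + c₁ * y + c₂ * z = w + c₀ * t := by rw [hw]; ring
    rw [e1, e2, e3] at h1
    simp only [phi4] at h1
    simp only [Polynomial.eval_add, Polynomial.eval_mul, Polynomial.eval_pow, Polynomial.eval_C,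
      Polynomial.eval_X]
    linear_combination h1
  have h2 := congrArg (fun p => Polynomial.eval 0 (Polynomial.derivative p)) hp
  simp [Polynomial.derivative_pow] at h2
  linear_combination h2

/-- Binary form step. -/
lemma step2 [CharZero K] (e : ℕ) (he : e ≠ 1) (α p q r s lam : K) (hα : α ≠ 0)
    (hdet : p * s - q * r ≠ 0)
    (h : ∀ t : K, (p + q * t) ^ (e + 4) * (r + s * t) + α * (p + q * t) * (r + s * t) ^ (e + 4)
      = lam * (t + α * t ^ (e + 4))) :
    (q = 0 ∧ r = 0) ∨ (p = 0 ∧ s = 0) := by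
  have h4 : (e + 4 : K) ≠ 0 := by exact_mod_cast (by omega : e + 4 ≠ 0)
  have hc2 : ((e + 4).choose 2 : K) ≠ 0 := by
      exact_mod_cast (Nat.choose_pos (by omega)).ne'
  have hc23 : ((e + 4).choose 3 : K) - ((e + 4).choose 2 : K) ≠ 0 := by
    rw [sub_ne_zero]
    intro h'
    have h'' : (e + 4).choose 3 = (e + 4).choose 2 := by exact_mod_cast h'
    have h3 := Nat.choose_succ_right_eq (e + 4) 2
    rw [h''] at h3
    have : 0 < (e + 4).choose 2 := Nat.choose_pos (by omega)
    have := Nat.eq_of_mul_eq_mul_left this h3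
    omega
  have hp : ((Polynomial.C q * Polynomial.X + Polynomial.C p) ^ (e + 4) * Polynomial.C r
        + (Polynomial.C q * Polynomial.X + Polynomial.C p) ^ (e + 4) * Polynomial.C s * Polynomial.X
        + ((Polynomial.C s * Polynomial.X + Polynomial.C r) ^ (e + 4) * Polynomial.C (α * p)
        + (Polynomial.C s * Polynomial.X + Polynomial.C r) ^ (e + 4) * Polynomial.C (α * q)
          * Polynomial.X) : Polynomial K)
      = Polynomial.C lam * (Polynomial.X + Polynomial.C α * Polynomial.X ^ (e + 4)) := by
    apply Polynomial.funext
    intro t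
    have h1 := h t
    simp only [Polynomial.eval_add, Polynomial.eval_mul, Polynomial.eval_pow, Polynomial.eval_C,
      Polynomial.eval_X]
    linear_combination h1
  have k0 := h 0
  have k2 := congrArg (fun p => Polynomial.coeff p 2) hp
  have k3 := congrArg (fun p => Polynomial.coeff p 3) hp
  simp only [Polynomial.coeff_add, Polynomial.coeff_mul_X, Polynomial.coeff_mul_C,
    Polynomial.coeff_C_mul, coeff_lin_pow, Polynomial.coeff_X_pow, Polynomial.coeff_X,
    show e + 4 - 2 = e + 2 by omega, show e + 4 - 1 = e + 3 by omega,
    show e + 4 - 3 = e + 1 by omega, show (2 : ℕ) ≠ e + 4 by omega,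
    show (3 : ℕ) ≠ e + 4 by omega, if_false, Nat.choose_one_right] at k2 k3
  norm_num at k0 k2 k3
  by_cases hp0 : p = 0
  · right
    refine ⟨hp0, ?_⟩
    subst hp0
    have hq : q ≠ 0 := by rintro rfl; simp at hdet
    have hr : r ≠ 0 := by rintro rfl; simp at hdet
    have : (e + 4) * s * r ^ (e + 3) * (α * q) = 0 := by
      simpa using k2
    simpa [h4, hq, hr, hα] using this
  by_cases hr0 : r = 0
  · left
    refine ⟨?_, hr0⟩
    subst hr0
    have hs : s ≠ 0 := by rintro rfl; simp at hdet
    have : (e + 4) * q * p ^ (e + 3) * s = 0 := by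
      simpa using k2
    simpa [h4, hp0, hs] using this
  exfalso
  obtain ⟨x, rfl⟩ : ∃ x, q = p * x := ⟨q / p, by field_simp⟩
  obtain ⟨y, rfl⟩ : ∃ y, s = r * y := ⟨s / r, by field_simp⟩
  have hxy : x - y ≠ 0 := by
    intro h0
    apply hdet
    linear_combination (-p * r) * h0
  have k0' : p ^ (e + 3) + α * r ^ (e + 3) = 0 := by
    have : (p * r) * (p ^ (e + 3) + α * r ^ (e + 3)) = 0 := by linear_combination k0
    simpa [hp0, hr0] using this
  have hR : α * r ^ (e + 3) = - p ^ (e + 3) := by linear_combination k0'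
  have hnz : p ^ (e + 4) * r ≠ 0 := by simp [hp0, hr0]
  have k2' : ((e + 4).choose 2 : K) * (x ^ 2 - y ^ 2) = 0 := by
    apply mul_left_cancel₀ hnz
    linear_combination k2 + (-((e + 4).choose 2 : K) * y ^ 2 * p * r - (e+4) * y * p * x * r) * hR
  have k3' : ((e + 4).choose 3 : K) * (x ^ 3 - y ^ 3) +
      ((e + 4).choose 2 : K) * (x ^ 2 * y - y ^ 2 * x) = 0 := by
    apply mul_left_cancel₀ hnz
    linear_combination k3 + (-((e + 4).choose 3 : K) * y ^ 3 * p * r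
      - ((e + 4).choose 2 : K) * y ^ 2 * p * x * r) * hR
  have hyx : y = - x := by
    have : (x - y) * (x + y) = 0 := by
      have := (mul_eq_zero.mp k2').resolve_left hc2
      linear_combination this
    linear_combination (mul_eq_zero.mp this).resolve_left hxy
  subst hyx
  have : x ^ 3 * 2 * (((e + 4).choose 3 : K) - ((e + 4).choose 2 : K)) = 0 := by
    linear_combination k3'
  have hx : x = 0 := by simpa [hc23] using this
  simp [hx] at hxy

lemma normal_form {P : Type*} [Group P] (s t : P) (k : ℤ) (hs : s * s = 1)
    (hst : s * t * s = t ^ k) (H : ∀ L : Subgroup P, s ∈ L → t ∈ L → ∀ x, x ∈ L) (x : P) :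
    ∃ i : ℤ, x = t ^ i ∨ x = s * t ^ i := by
  have hinv : s⁻¹ = s := inv_eq_of_mul_eq_one_right hs
  have hconj : ∀ i : ℤ, s * t ^ i * s = t ^ (k * i) := by
    intro i
    have h1 := conj_zpow (i := i) (a := s) (b := t)
    rw [hinv, hst] at h1
    rw [← h1, _root_.zpow_mul]
  have hsw : ∀ i : ℤ, t ^ i * s = s * t ^ (k * i) := by
    intro i
    rw [← hconj i, ← mul_assoc, ← mul_assoc, hs, one_mul]
  let L : Subgroup P :=
    { carrier := {x | ∃ i : ℤ, x = t ^ i ∨ x = s * t ^ i}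
      one_mem' := ⟨0, by simp⟩
      mul_mem' := by
        rintro x y ⟨i, rfl | rfl⟩ ⟨j, rfl | rfl⟩
        · exact ⟨i + j, Or.inl (_root_.zpow_add _ _ _).symm⟩
        · refine ⟨k * i + j, Or.inr ?_⟩
          rw [← mul_assoc, hsw, mul_assoc, _root_.zpow_add]
        · exact ⟨i + j, Or.inr (by rw [mul_assoc, _root_.zpow_add])⟩
        · refine ⟨k * i + j, Or.inl ?_⟩
          rw [← mul_assoc, hconj, _root_.zpow_add]
      inv_mem' := by
        rintro x ⟨i, rfl | rfl⟩
        · exact ⟨-i, Or.inl (_root_.zpow_neg _ _).symm⟩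
        · refine ⟨k * (-i), Or.inr ?_⟩
          rw [_root_.mul_inv_rev, hinv, ← _root_.zpow_neg, hsw] }
  exact H L ⟨0, by simp⟩ ⟨1, by simp⟩ x

lemma group_final {G : Type*} [Group G] (d : ℕ) (s t : G)
    (hs : s * s = 1) (ht : orderOf t = d * (d - 2)) (hst : s * t * s = t ^ (-((d : ℤ) - 1)))
    (hd : 1 ≤ d) (hns : ∀ i : ℤ, s ≠ t ^ i)
    (hG : ∀ g : G, ∃ i : ℤ, g = t ^ i ∨ g = s * t ^ i) :
    Nonempty (G ≃* PresentedGroup (rels4 d)) ∧ Nat.card G = 2 * d * (d - 2) := by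
  have hinv : s⁻¹ = s := inv_eq_of_mul_eq_one_right hs
  have hcast : ((d - 1 : ℕ) : ℤ) = (d : ℤ) - 1 := by omega
  constructor
  · have hrel : ∀ r ∈ rels4 d, FreeGroup.lift (fun b : Bool => if b then s else t) r = 1 := by
      intro r hr
      simp only [rels4, Set.mem_insert_iff, Set.mem_singleton_iff] at hr
      rcases hr with rfl | rfl | rfl
      · simp [pow_two, hs]
      · simp [← ht, pow_orderOf_eq_one]
      · simp only [map_mul, map_pow, FreeGroup.lift_apply_of, if_true]
        simp only [Bool.false_eq_true, if_false]
        rw [hst, ← zpow_natCast, hcast, ← _root_.zpow_add]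
        simp
    let f : PresentedGroup (rels4 d) →* G := PresentedGroup.toGroup hrel
    let s' : PresentedGroup (rels4 d) := PresentedGroup.of true
    let t' : PresentedGroup (rels4 d) := PresentedGroup.of false
    have fs : f s' = s := by simp [f, s', PresentedGroup.toGroup.of]
    have ft : f t' = t := by simp [f, t', PresentedGroup.toGroup.of]
    have r1 : s' ^ 2 = 1 :=
      PresentedGroup.one_of_mem (rels := rels4 d) (x := FreeGroup.of true ^ 2) (by simp [rels4])
    have r2 : t' ^ (d * (d - 2)) = 1 :=
      PresentedGroup.one_of_mem (rels := rels4 d) (x := FreeGroup.of false ^ (d * (d - 2)))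
        (by simp [rels4])
    have r3 : s' * t' * s' * t' ^ (d - 1) = 1 :=
      PresentedGroup.one_of_mem (rels := rels4 d) (x := FreeGroup.of true * FreeGroup.of false *
        FreeGroup.of true * FreeGroup.of false ^ (d - 1)) (by simp [rels4])
    have r3' : s' * t' * s' = t' ^ (-((d : ℤ) - 1)) := by
      rw [_root_.zpow_neg, ← hcast, zpow_natCast]
      exact eq_inv_of_mul_eq_one_left r3
    have hnf := normal_form s' t' _ (by rw [← pow_two]; exact r1) r3' (by
      intro L h1 h2 x
      exact PresentedGroup.generated_by (rels4 d) L (by rintro (_ | _); exacts [h2, h1]) x)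
    have hinj : Function.Injective f := by
      rw [injective_iff_map_eq_one]
      intro x hx
      obtain ⟨i, rfl | rfl⟩ := hnf x
      · rw [map_zpow, ft] at hx
        have := orderOf_dvd_iff_zpow_eq_one.mpr hx
        rw [ht] at this
        obtain ⟨j, rfl⟩ := this
        rw [_root_.zpow_mul, zpow_natCast, r2, _root_.one_zpow]
      · rw [map_mul, map_zpow, ft, fs] at hx
        exact absurd (eq_inv_of_mul_eq_one_left hx) (by rw [← _root_.zpow_neg]; exact hns _)
    have hsurj : Function.Surjective f := by
      intro g
      obtain ⟨i, rfl | rfl⟩ := hG g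
      · exact ⟨t' ^ i, by rw [map_zpow, ft]⟩
      · exact ⟨s' * t' ^ i, by rw [map_mul, map_zpow, ft, fs]⟩
    exact ⟨(MulEquiv.ofBijective f ⟨hinj, hsurj⟩).symm⟩
  · have hsH : s ∉ Subgroup.zpowers t := by
      rintro ⟨i, hi⟩
      exact hns i hi.symm
    have hidx : (Subgroup.zpowers t).index = 2 := by
      rw [Subgroup.index_eq_two_iff]
      refine ⟨s, fun b => ?_⟩
      obtain ⟨i, rfl | rfl⟩ := hG b
      · right
        refine ⟨⟨i, rfl⟩, fun h => hsH ?_⟩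
        exact (Subgroup.mul_mem_cancel_left _ (Subgroup.zpow_mem_zpowers t i)).mp h
      · left
        refine ⟨?_, fun h => hsH ?_⟩
        · have h1 := conj_zpow (i := i) (a := s) (b := t)
          rw [hinv, hst] at h1
          rw [← h1, ← _root_.zpow_mul]
          exact ⟨_, rfl⟩
        · exact (Subgroup.mul_mem_cancel_right _ (Subgroup.zpow_mem_zpowers t i)).mp h
    rw [← Subgroup.card_mul_index (Subgroup.zpowers t), hidx, Nat.card_zpowers, ht]
    ring

/-- The curve in degree `e + 5`. -/
abbrev F4 (e : ℕ) (α : K) : MvPolynomial (Fin 3) K :=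
  X 0 ^ (e + 5) + X 1 ^ (e + 4) * X 2 + C α * X 1 * X 2 ^ (e + 4)

lemma autGL_eval (e : ℕ) (α : K) (A : GL (Fin 3) K) (hA : A ∈ autGL (F4 e α)) :
    ∃ lam : K, lam ≠ 0 ∧ ∀ x y z : K,
      phi4 e α (A.1 0 0 * x + A.1 0 1 * y + A.1 0 2 * z) (A.1 1 0 * x + A.1 1 1 * y + A.1 1 2 * z)
        (A.1 2 0 * x + A.1 2 1 * y + A.1 2 2 * z) = lam * phi4 e α x y z := by
  obtain ⟨c, hc⟩ := hA
  refine ⟨c, c.ne_zero, fun x y z => ?_⟩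
  have := congrArg (eval ![x, y, z]) hc
  simp [substPoly, Fin.sum_univ_three, smul_eval] at this
  simp only [phi4]
  linear_combination this

lemma autGL_block [CharZero K] (e : ℕ) (α : K) (hα : α ≠ 0) (A : GL (Fin 3) K)
    (hA : A ∈ autGL (F4 e α)) :
    A.1 0 1 = 0 ∧ A.1 0 2 = 0 ∧ A.1 1 0 = 0 ∧ A.1 2 0 = 0 := by
  obtain ⟨lam, hlam, h⟩ := autGL_eval e α A hA
  obtain ⟨B, hB⟩ : ∃ B : Matrix (Fin 3) (Fin 3) K, B = (A⁻¹ : GL (Fin 3) K).1 := ⟨_, rfl⟩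
  have hAB : A.1 * B = 1 := by rw [hB]; exact A.mul_inv
  have hBA : B * A.1 = 1 := by rw [hB]; exact A.inv_mul
  have key : ∀ i j, A.1 i 0 * B 0 j + A.1 i 1 * B 1 j + A.1 i 2 * B 2 j
      = (1 : Matrix (Fin 3) (Fin 3) K) i j := by
    intro i j
    rw [← hAB, Matrix.mul_apply, Fin.sum_univ_three]
  have key' : ∀ i j, B i 0 * A.1 0 j + B i 1 * A.1 1 j + B i 2 * A.1 2 j
      = (1 : Matrix (Fin 3) (Fin 3) K) i j := by
    intro i j
    rw [← hBA, Matrix.mul_apply, Fin.sum_univ_three]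
  have h1 := step1 e α (A.1 0 0) (A.1 1 0) (A.1 2 0) (B 0 0) (B 0 1) (B 0 2) lam hα hlam
    (by
      rintro ⟨h0, h1, h2⟩
      have := key' 0 0
      simp [h0, h1, h2] at this)
    (by
      intro x y z
      have e0 := key 0
      have e1 := key 1
      have e2 := key 2
      have a0 := e0 0
      have a1 := e0 1
      have a2 := e0 2
      have b0 := e1 0
      have b1 := e1 1
      have b2 := e1 2
      have c0 := e2 0
      have c1 := e2 1
      have c2 := e2 2
      simp [Matrix.one_apply] at a0 a1 a2 b0 b1 b2 c0 c1 c2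
      refine deriv_step e α lam _ _ _ _ _ _ _ _ _ h (B 0 0 * x + B 0 1 * y + B 0 2 * z)
        (B 1 0 * x + B 1 1 * y + B 1 2 * z) (B 2 0 * x + B 2 1 * y + B 2 2 * z) x y z ?_ ?_ ?_
      · linear_combination -x * a0 - y * a1 - z * a2
      · linear_combination -x * b0 - y * b1 - z * b2
      · linear_combination -x * c0 - y * c1 - z * c2)
  obtain ⟨h10, h20, m0, n0⟩ := h1
  have k0 := key' 0 0
  have k1 := key' 0 1
  have k2 := key' 0 2
  simp [Matrix.one_apply, m0, n0] at k0 k1 k2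
  have hB0 : B 0 0 ≠ 0 := by
    intro h0
    simp [h0] at k0
  exact ⟨k1.resolve_left hB0, k2.resolve_left hB0, h10, h20⟩

lemma autGL_mono [CharZero K] (e : ℕ) (he : e ≠ 1) (α : K) (hα : α ≠ 0) (A : GL (Fin 3) K)
    (hA : A ∈ autGL (F4 e α)) :
    (A.1 1 2 = 0 ∧ A.1 2 1 = 0) ∨ (A.1 1 1 = 0 ∧ A.1 2 2 = 0) := by
  obtain ⟨h01, h02, h10, h20⟩ := autGL_block e α hα A hA
  obtain ⟨lam, hlam, h⟩ := autGL_eval e α A hA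
  have hdet : A.1.det ≠ 0 := ((Matrix.isUnit_iff_isUnit_det _).mp A.isUnit).ne_zero
  rw [Matrix.det_fin_three, h01, h02, h10, h20] at hdet
  apply step2 e he α (A.1 1 1) (A.1 1 2) (A.1 2 1) (A.1 2 2) lam hα
  · intro h0
    apply hdet
    linear_combination A.1 0 0 * h0
  · intro t
    have := h 0 1 t
    simp [phi4, h01, h02] at this
    linear_combination this

/-- The diagonal torus. -/
def hMat (e : ℕ) : Kˣ →* Matrix (Fin 3) (Fin 3) K where
  toFun u := Matrix.diagonal ![1, (u : K), ((u⁻¹ : Kˣ) : K) ^ (e + 4)]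
  map_one' := by
    ext i j; fin_cases i <;> fin_cases j <;> simp
  map_mul' u v := by
    rw [Matrix.diagonal_mul_diagonal]
    congr 1
    funext i
    fin_cases i <;> simp [mul_pow, mul_comm]

/-- The torus in `GL₃`. -/
def hGL (e : ℕ) : Kˣ →* GL (Fin 3) K := (hMat e).toHomUnits

lemma hGL_val (e : ℕ) (u : Kˣ) :
    (hGL e u).1 = Matrix.diagonal ![1, (u : K), ((u⁻¹ : Kˣ) : K) ^ (e + 4)] := rfl

lemma hGL_val2 (e : ℕ) (u : Kˣ) :
    (hGL e u).1 = !![1, 0, 0; 0, (u : K), 0; 0, 0, ((u⁻¹ : Kˣ) : K) ^ (e + 4)] := by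
  rw [hGL_val]
  ext i j
  fin_cases i <;> fin_cases j <;> simp

/-- The torus in `PGL₃`. -/
def hPGL (e : ℕ) : Kˣ →* PGL3 K :=
  (QuotientGroup.mk' (Subgroup.center (GL (Fin 3) K))).comp (hGL e)

/-- The swap. -/
def sigGL (s : Kˣ) : GL (Fin 3) K where
  val := !![1, 0, 0; 0, 0, (s : K); 0, ((s⁻¹ : Kˣ) : K), 0]
  inv := !![1, 0, 0; 0, 0, (s : K); 0, ((s⁻¹ : Kˣ) : K), 0]
  val_inv := by
    ext i j; fin_cases i <;> fin_cases j <;> simp [Matrix.mul_apply, Fin.sum_univ_three]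
  inv_val := by
    ext i j; fin_cases i <;> fin_cases j <;> simp [Matrix.mul_apply, Fin.sum_univ_three]

lemma sigGL_val (s : Kˣ) :
    (sigGL s).1 = !![1, 0, 0; 0, 0, (s : K); 0, ((s⁻¹ : Kˣ) : K), 0] := rfl

lemma sigGL_sq (s : Kˣ) : sigGL s * sigGL s = 1 :=
  Units.ext (sigGL s).val_inv

lemma mk_eq_iff (A B : GL (Fin 3) K) :
    (QuotientGroup.mk' (Subgroup.center (GL (Fin 3) K)) A
      = QuotientGroup.mk' (Subgroup.center (GL (Fin 3) K)) B) ↔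
      ∃ c : K, A.1 * Matrix.diagonal (fun _ => c) = B.1 := by
  rw [QuotientGroup.mk'_apply, QuotientGroup.mk'_apply, QuotientGroup.eq,
    Matrix.GeneralLinearGroup.mem_center_iff_val_mem_range_scalar]
  constructor
  · rintro ⟨c, hc⟩
    refine ⟨c, ?_⟩
    have : (Matrix.diagonal (fun _ => c) : Matrix (Fin 3) (Fin 3) K) = (A⁻¹ * B : GL (Fin 3) K).1 :=
      hc
    rw [this, ← Units.val_mul, mul_inv_cancel_left]
  · rintro ⟨c, hc⟩
    refine ⟨c, ?_⟩
    have h1 : (A⁻¹ * B : GL (Fin 3) K).1 = (A⁻¹ : GL (Fin 3) K).1 * B.1 := rfl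
    have h2 : (A⁻¹ : GL (Fin 3) K).1 * A.1 = 1 := A.inv_mul
    rw [h1, ← hc, ← mul_assoc, h2, one_mul]
    rfl

lemma hPGL_injective (e : ℕ) : Function.Injective (hPGL e : Kˣ →* PGL3 K) := by
  intro u v h
  obtain ⟨c, hc⟩ := (mk_eq_iff _ _).mp h
  rw [hGL_val, hGL_val, Matrix.diagonal_mul_diagonal] at hc
  have h0 := congrFun (congrFun hc 0) 0
  have h1 := congrFun (congrFun hc 1) 1
  simp at h0 h1
  ext
  simpa [h0] using h1

lemma sig_ne (e : ℕ) (s u : Kˣ) :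
    QuotientGroup.mk' (Subgroup.center (GL (Fin 3) K)) (sigGL s) ≠ hPGL e u := by
  intro h
  obtain ⟨c, hc⟩ := (mk_eq_iff _ _).mp h
  rw [hGL_val, sigGL_val] at hc
  have h0 := congrFun (congrFun hc 1) 1
  simp at h0
  exact u.ne_zero h0.symm

lemma sig_conj (e : ℕ) (s u : Kˣ) (hu : u ^ ((e + 5) * (e + 3)) = 1) :
    sigGL s * hGL e u * sigGL s = hGL e (u⁻¹ ^ (e + 4)) := by
  have h2 : ((u ^ (e + 4)) ^ (e + 4) : Kˣ) = u := by
    rw [← pow_mul, show (e + 4) * (e + 4) = (e + 5) * (e + 3) + 1 by ring, pow_succ, hu, one_mul]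
  have h2' : (((u : K) ^ (e + 4)) ^ (e + 4)) = u := by exact_mod_cast congrArg Units.val h2
  apply Units.ext
  rw [Units.val_mul, Units.val_mul, hGL_val2, hGL_val2, sigGL_val]
  ext i j
  fin_cases i <;> fin_cases j <;>
    simp [Matrix.mul_apply, Fin.sum_univ_three, h2', mul_comm]

lemma hGL_mem (e : ℕ) (α : K) (u : Kˣ) (hu : u ^ ((e + 5) * (e + 3)) = 1) :
    hGL e u ∈ autGL (F4 e α) := by
  have h2 : ((u⁻¹ ^ (e + 4)) ^ (e + 4) : Kˣ) = u⁻¹ := by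
    rw [← pow_mul, show (e + 4) * (e + 4) = (e + 5) * (e + 3) + 1 by ring, pow_succ, inv_pow, hu]
    simp
  have h1 : (u : K) ^ (e + 4) * ((u⁻¹ : Kˣ) : K) ^ (e + 4) = 1 := by
    rw [← mul_pow]; simp
  have h3 : (u : K) * (((u⁻¹ : Kˣ) : K) ^ (e + 4)) ^ (e + 4) = 1 := by
    have : (((u⁻¹ : Kˣ) : K) ^ (e + 4)) ^ (e + 4) = ((u⁻¹ : Kˣ) : K) := by
      exact_mod_cast congrArg Units.val h2
    rw [this]; simp
  refine ⟨1, ?_⟩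
  rw [hGL_val2]
  generalize ((u⁻¹ : Kˣ) : K) ^ (e + 4) = v at h1 h3 ⊢
  have h1' := congrArg (C (σ := Fin 3)) h1
  have h3' := congrArg (C (σ := Fin 3)) h3
  simp only [substPoly, map_add, map_mul, map_pow, aeval_X, aeval_C, Fin.sum_univ_three,
    smul_eq_C_mul] at h1' h3' ⊢
  simp at h1' h3' ⊢
  linear_combination (X 1 ^ (e + 4) * X 2) * h1' + (C α * X 1 * X 2 ^ (e + 4)) * h3'

lemma sigGL_mem (e : ℕ) (α : K) (s : Kˣ) (hs : (s : K) ^ (e + 3) = α) :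
    sigGL s ∈ autGL (F4 e α) := by
  have h1 : (s : K) ^ (e + 4) * ((s⁻¹ : Kˣ) : K) = α := by
    rw [pow_succ, mul_assoc, hs]; simp
  have h3 : α * (s : K) * ((s⁻¹ : Kˣ) : K) ^ (e + 4) = 1 := by
    rw [← hs, ← pow_succ, ← mul_pow]; simp
  refine ⟨1, ?_⟩
  have h1' := congrArg (C (σ := Fin 3)) h1
  have h3' := congrArg (C (σ := Fin 3)) h3
  rw [sigGL_val]
  simp only [substPoly, map_add, map_mul, map_pow, aeval_X, aeval_C, Fin.sum_univ_three,
    smul_eq_C_mul] at h1' h3' ⊢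
  simp at h1' h3' ⊢
  linear_combination (X 2 ^ (e + 4) * X 1) * h1' + (X 2 * X 1 ^ (e + 4)) * h3'

lemma autGL_diag [CharZero K] (e : ℕ) (α : K) (hα : α ≠ 0) (A : GL (Fin 3) K)
    (hA : A ∈ autGL (F4 e α)) (h12 : A.1 1 2 = 0) (h21 : A.1 2 1 = 0) :
    ∃ u : Kˣ, u ^ ((e + 5) * (e + 3)) = 1 ∧
      hPGL e u = QuotientGroup.mk' (Subgroup.center (GL (Fin 3) K)) A := by
  obtain ⟨h01, h02, h10, h20⟩ := autGL_block e α hα A hA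
  obtain ⟨lam, hlam, h⟩ := autGL_eval e α A hA
  have hdet : A.1.det ≠ 0 := ((Matrix.isUnit_iff_isUnit_det _).mp A.isUnit).ne_zero
  rw [Matrix.det_fin_three, h01, h02, h10, h20, h12, h21] at hdet
  simp only [h01, h02, h10, h20, h12, h21] at h
  obtain ⟨a, ha⟩ : ∃ a, a = A.1 0 0 := ⟨_, rfl⟩
  obtain ⟨p, hp⟩ : ∃ a, a = A.1 1 1 := ⟨_, rfl⟩
  obtain ⟨s, hs⟩ : ∃ a, a = A.1 2 2 := ⟨_, rfl⟩
  rw [← ha, ← hp, ← hs] at h hdet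
  have hdet' : a * p * s ≠ 0 := by simpa using hdet
  have ha0 : a ≠ 0 := by rintro rfl; simp at hdet'
  have hp0 : p ≠ 0 := by rintro rfl; simp at hdet'
  have hs0 : s ≠ 0 := by rintro rfl; simp at hdet'
  have e1 := h 1 0 0
  have e2 := h 0 1 1
  have e3 : α * p * s ^ (e + 4) = lam * α := by
    have hpoly : (Polynomial.C (p ^ (e + 4) * s) * Polynomial.X ^ (e + 4)
        + Polynomial.C (α * p * s ^ (e + 4)) * Polynomial.X : Polynomial K)
        = Polynomial.C lam * Polynomial.X ^ (e + 4) + Polynomial.C (lam * α) * Polynomial.X := by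
      apply Polynomial.funext
      intro t
      have := h 0 t 1
      simp only [phi4] at this
      simp only [Polynomial.eval_add, Polynomial.eval_mul, Polynomial.eval_pow, Polynomial.eval_C,
        Polynomial.eval_X]
      simp at this
      linear_combination this
    have := congrArg (fun q => Polynomial.coeff q 1) hpoly
    simp only [Polynomial.coeff_add, Polynomial.coeff_C_mul, Polynomial.coeff_X_pow,
      Polynomial.coeff_X_one, show (1 : ℕ) ≠ e + 4 by omega, if_false] at this
    linear_combination this
  simp [phi4] at e1 e2
  have f1 : p ^ (e + 4) * s = a ^ (e + 5) := by rw [e1]; linear_combination e2 - e3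
  have f2 : p * s ^ (e + 4) = a ^ (e + 5) := by
    apply mul_left_cancel₀ hα
    rw [e1]; linear_combination e3
  have g1 : (p / a) ^ (e + 4) * (s / a) = 1 := by
    rw [div_pow, div_mul_div_comm, f1, ← pow_succ]
    exact div_self (pow_ne_zero _ ha0)
  have g2 : (p / a) * (s / a) ^ (e + 4) = 1 := by
    rw [div_pow, div_mul_div_comm, f2, ← pow_succ']
    exact div_self (pow_ne_zero _ ha0)
  have hsa : s / a = ((p / a)⁻¹) ^ (e + 4) := by
    rw [inv_pow]; exact eq_inv_of_mul_eq_one_right g1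
  have hu0 : p / a ≠ 0 := div_ne_zero hp0 ha0
  refine ⟨Units.mk0 (p / a) hu0, ?_, ?_⟩
  · ext
    simp only [Units.val_pow_eq_pow_val, Units.val_mk0, Units.val_one]
    have g3 : (p / a) ^ ((e + 4) * (e + 4)) * (s / a) ^ (e + 4) = 1 := by
      rw [pow_mul, ← mul_pow, g1, one_pow]
    rw [show (e + 4) * (e + 4) = (e + 5) * (e + 3) + 1 by ring, pow_succ, mul_assoc, g2,
      mul_one] at g3
    exact g3
  · apply (mk_eq_iff _ _).mpr
    refine ⟨a, ?_⟩
    rw [hGL_val, Matrix.diagonal_mul_diagonal]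
    have hs' : ((p / a)⁻¹) ^ (e + 4) * a = s := by rw [← hsa]; field_simp
    have hp' : p / a * a = p := by field_simp
    ext i j
    fin_cases i <;> fin_cases j <;>
      simp [h01, h02, h10, h20, h12, h21, ← ha, ← hp, ← hs, hp']
    exact (by rw [_root_.inv_div, div_pow] : _ = ((p / a)⁻¹) ^ (e + 4) * a).trans hs'

end helpers

/-- for `d ≥ 5`, `d ≠ 6` and `α ≠ 0`, the automorphism group of
`X^d + Y^(d-1)·Z + α·Y·Z^(d-1)` is isomorphic to
`⟨σ, τ ∣ σ² = τ^(d(d-2)) = 1, στσ = τ^(-(d-1))⟩`; in particular it has order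
`2d(d-2)`, and contains `τ` of order `d(d-2)` and `σ` of order 2 with
`στσ = τ^(-(d-1))`. -/
theorem stmt4 {K : Type*} [Field K] [IsAlgClosed K] [CharZero K]
    (d : ℕ) (hd : 5 ≤ d) (hd6 : d ≠ 6) (α : K) (hα : α ≠ 0)
    (F : MvPolynomial (Fin 3) K)
    (hF : F = X 0 ^ d + X 1 ^ (d - 1) * X 2 + C α * X 1 * X 2 ^ (d - 1)) :
    Nonempty (↥(projAut F) ≃* PresentedGroup (rels4 d)) ∧
    Nat.card ↥(projAut F) = 2 * d * (d - 2) ∧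
    ∃ σ τ : PGL3 K, σ ∈ projAut F ∧ τ ∈ projAut F ∧
      orderOf τ = d * (d - 2) ∧ orderOf σ = 2 ∧
      σ * τ * σ = τ ^ (-((d : ℤ) - 1)) := by
  obtain ⟨e, rfl⟩ : ∃ e, d = e + 5 := ⟨d - 5, by omega⟩
  have he : e ≠ 1 := by omega
  have hF' : F = F4 e α := hF
  clear hF
  subst hF'
  have hN : (e + 5) * (e + 5 - 2) = (e + 5) * (e + 3) := rfl
  have hN0 : (e + 5) * (e + 3) ≠ 0 := by positivity
  have : NeZero ((e + 5) * (e + 3)) := ⟨hN0⟩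
  have : NeZero (((e + 5) * (e + 3) : ℕ) : K) := ⟨by exact_mod_cast hN0⟩
  obtain ⟨z, hz⟩ := HasEnoughRootsOfUnity.exists_primitiveRoot K ((e + 5) * (e + 3))
  obtain ⟨ζ, hζz⟩ := hz.isUnit hN0
  have hζ : IsPrimitiveRoot ζ ((e + 5) * (e + 3)) := by
    rw [← IsPrimitiveRoot.coe_units_iff, hζz]; exact hz
  obtain ⟨s₀, hs₀⟩ := IsAlgClosed.exists_pow_nat_eq α (show 0 < e + 3 by omega)
  have hs₀0 : s₀ ≠ 0 := by
    rintro rfl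
    apply hα
    rw [← hs₀]; simp
  let s : Kˣ := Units.mk0 s₀ hs₀0
  let q := QuotientGroup.mk' (Subgroup.center (GL (Fin 3) K))
  let σ : PGL3 K := q (sigGL s)
  let τ : PGL3 K := hPGL e ζ
  have hsmem : sigGL s ∈ autGL (F4 e α) := sigGL_mem e α s hs₀
  have hσ : σ ∈ projAut (F4 e α) := ⟨_, hsmem, rfl⟩
  have hτ : τ ∈ projAut (F4 e α) := ⟨_, hGL_mem e α ζ hζ.pow_eq_one, rfl⟩
  have hτo : orderOf τ = (e + 5) * (e + 5 - 2) := by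
    rw [hN, hζ.eq_orderOf]
    exact orderOf_injective _ (hPGL_injective e) ζ
  have hσσ : σ * σ = 1 := by
    have := congrArg q (sigGL_sq s)
    rw [map_mul, map_one] at this
    exact this
  have hne : ∀ i : ℤ, σ ≠ τ ^ i := by
    intro i
    rw [← map_zpow]
    exact sig_ne e s _
  have hσo : orderOf σ = 2 := by
    apply orderOf_eq_prime
    · rw [pow_two, hσσ]
    · exact hne 0
  have hστ : σ * τ * σ = τ ^ (-(((e + 5 : ℕ) : ℤ) - 1)) := by
    have h1 := congrArg q (sig_conj e s ζ hζ.pow_eq_one)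
    rw [map_mul, map_mul] at h1
    have h2 : τ ^ (-(((e + 5 : ℕ) : ℤ) - 1)) = hPGL e (ζ⁻¹ ^ (e + 4)) := by
      rw [← map_zpow]
      congr 1
      rw [inv_pow, _root_.zpow_neg, ← zpow_natCast]
      congr 2
      push_cast
      ring
    rw [h2]
    exact h1
  have hdiag : ∀ A ∈ autGL (F4 e α), A.1 1 2 = 0 → A.1 2 1 = 0 → ∃ i : ℤ, q A = τ ^ i := by
    intro A hA h12 h21
    obtain ⟨u, hu, hA'⟩ := autGL_diag e α hα A hA h12 h21
    obtain ⟨i, hi⟩ : u ∈ Subgroup.zpowers ζ := by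
      rw [hζ.zpowers_eq]
      exact (mem_rootsOfUnity _ _).mpr hu
    refine ⟨i, ?_⟩
    rw [← map_zpow]
    rw [show q A = hPGL e u from hA'.symm, ← hi]
  have hall : ∀ g ∈ projAut (F4 e α), ∃ i : ℤ, g = τ ^ i ∨ g = σ * τ ^ i := by
    rintro g ⟨A, hA, rfl⟩
    rcases autGL_mono e he α hα A hA with ⟨h1, h2⟩ | ⟨h1, h2⟩
    · obtain ⟨i, hi⟩ := hdiag A hA h1 h2
      exact ⟨i, Or.inl hi⟩
    · have hv : (sigGL s * A).1 = (sigGL s).1 * A.1 := rfl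
      obtain ⟨i, hi⟩ := hdiag (sigGL s * A) (mul_mem hsmem hA)
        (by rw [hv, sigGL_val, Matrix.mul_apply, Fin.sum_univ_three]; simp [h2])
        (by rw [hv, sigGL_val, Matrix.mul_apply, Fin.sum_univ_three]; simp [h1])
      refine ⟨i, Or.inr ?_⟩
      rw [← hi, map_mul, ← mul_assoc]
      change _ = (σ * σ) * _
      rw [hσσ, one_mul]
  have hfin := group_final (G := projAut (F4 e α)) (e + 5) ⟨σ, hσ⟩ ⟨τ, hτ⟩
    (Subtype.ext hσσ) (by rw [← hτo]; exact Subgroup.orderOf_mk τ hτ)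
    (Subtype.ext (by simpa using hστ)) (by omega)
    (by
      intro i hi
      exact hne i (by simpa using congrArg Subtype.val hi))
    (by
      rintro ⟨g, hg⟩
      obtain ⟨i, hi⟩ := hall g hg
      exact ⟨i, hi.imp (fun h => Subtype.ext (by simpa using h))
        (fun h => Subtype.ext (by simpa using h))⟩)
  exact ⟨hfin.1, hfin.2, σ, τ, hσ, hτ, hτo, hσo, hστ⟩


end
end

section
/- Let K be an algebraically closed field of characteristic 0 and let d ≥ 4. A nonsingular homogeneous polynomial F ∈ K[X,Y,Z] of degree d has an automorphism of order d(d−2) (i.e. Aut(F) contains an element of order d(d−2)) if and only if F is projectively equivalent to X^d + Y^{d−1}·Z + Y·Z^{d−1}. -/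
open MvPolynomial Matrix

noncomputable section

variable {K : Type*} [Field K]

section Helpers

/-- Effect of a diagonal substitution on coefficients. -/
lemma coeff_substPoly_diagonal (D : Fin 3 → K) (F : MvPolynomial (Fin 3) K) (m : Fin 3 →₀ ℕ) :
    coeff m (substPoly (Matrix.diagonal D) F) = (∏ i, D i ^ m i) * coeff m F := by
  have hfun : (fun i => ∑ j, (Matrix.diagonal D) i j • (X j : MvPolynomial (Fin 3) K))
      = fun i => C (D i) * X i := by
    funext i
    simp [Matrix.diagonal_apply, ite_smul, smul_eq_C_mul]
  unfold substPoly
  rw [hfun]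
  induction F using MvPolynomial.induction_on' with
  | monomial u a =>
    rw [aeval_monomial, Finsupp.prod_fintype _ _ (by simp)]
    simp only [mul_pow, Finset.prod_mul_distrib, ← C_pow]
    rw [← map_prod C, algebraMap_eq, mul_left_comm, coeff_C_mul, coeff_monomial]
    have : (C a * ∏ i, X i ^ u i : MvPolynomial (Fin 3) K) = monomial u a := by
      rw [monomial_eq, Finsupp.prod_fintype _ _ (by simp)]
    rw [this, coeff_monomial]
    split_ifs with h
    · rw [h]
    · simp
  | add p q hp hq => rw [map_add, coeff_add, coeff_add, hp, hq, mul_add]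

lemma eval_single_of_homogeneous {n : ℕ} {p : MvPolynomial (Fin 3) K} (hp : p.IsHomogeneous n)
    (i : Fin 3) : eval (Pi.single i 1) p = coeff (Finsupp.single i n) p := by
  rw [eval_eq']
  by_cases hs : Finsupp.single i n ∈ p.support
  · rw [Finset.sum_eq_single_of_mem _ hs]
    · rw [Finset.prod_eq_one, mul_one]
      intro j _
      by_cases h : j = i
      · subst h; simp
      · simp [Ne.symm h]
    · intro b hb hne
      rw [Finset.prod_eq_zero_iff.2, mul_zero]
      by_contra hcon
      apply hne
      have hz : ∀ j, j ≠ i → b j = 0 := by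
        intro j hj
        by_contra hb0
        exact hcon ⟨j, Finset.mem_univ _, by simp [hj, hb0]⟩
      have hdeg : b.degree = n := (by rw [Finsupp.degree_eq_weight_one]; exact hp (mem_support_iff.1 hb))
      rw [Finsupp.degree_eq_sum, Finset.sum_eq_single i (fun j _ hj => hz j hj) (by simp)] at hdeg
      ext j
      by_cases h : j = i
      · subst h; simp [hdeg]
      · rw [hz j h, Finsupp.single_apply, if_neg (Ne.symm h)]
  · rw [notMem_support_iff.1 hs]
    apply Finset.sum_eq_zero
    intro b hb
    rw [Finset.prod_eq_zero_iff.2, mul_zero]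
    by_contra hcon
    apply hs
    have hz : ∀ j, j ≠ i → b j = 0 := by
      intro j hj
      by_contra hb0
      exact hcon ⟨j, Finset.mem_univ _, by simp [hj, hb0]⟩
    have hdeg : b.degree = n := (by rw [Finsupp.degree_eq_weight_one]; exact hp (mem_support_iff.1 hb))
    rw [Finsupp.degree_eq_sum, Finset.sum_eq_single i (fun j _ hj => hz j hj) (by simp)] at hdeg
    have : b = Finsupp.single i n := by
      ext j
      by_cases h : j = i
      · subst h; simp [hdeg]
      · rw [hz j h, Finsupp.single_apply, if_neg (Ne.symm h)]
    rwa [← this]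

lemma exists_coeff_ne_zero {d : ℕ} {F : MvPolynomial (Fin 3) K}
    (hhom : F.IsHomogeneous d) (hns : IsNonsingular F) (i : Fin 3) :
    ∃ j, coeff (Finsupp.single i (d - 1) + Finsupp.single j 1) F ≠ 0 := by
  by_contra! h
  have := hns (Pi.single i 1) (fun j => by
    rw [eval_single_of_homogeneous hhom.pderiv, coeff_pderiv, h j, zero_mul])
  have h2 := congrFun this i
  simp at h2

lemma pderiv_substPoly (A : Matrix (Fin 3) (Fin 3) K) (F : MvPolynomial (Fin 3) K) (i : Fin 3) :
    pderiv i (substPoly A F) = ∑ j, A j i • substPoly A (pderiv j F) := by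
  unfold substPoly
  induction F using MvPolynomial.induction_on with
  | C a => simp
  | add p q hp hq => simp only [map_add, hp, hq, smul_add, Finset.sum_add_distrib]
  | mul_X p k hp =>
    have h1 : pderiv i (∑ j, A k j • (X j : MvPolynomial (Fin 3) K)) = C (A k i) := by
      simp [map_sum, pderiv_X, Pi.single_apply, smul_eq_C_mul]
    rw [map_mul, aeval_X, pderiv_mul, hp, h1]
    simp only [pderiv_mul, map_add, map_mul, aeval_X, smul_add, Finset.sum_add_distrib,
      Finset.sum_mul, smul_mul_assoc]
    congr 1
    simp [pderiv_X, Pi.single_apply, smul_eq_C_mul, mul_comm]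

lemma eval_substPoly (A : Matrix (Fin 3) (Fin 3) K) (F : MvPolynomial (Fin 3) K) (x : Fin 3 → K) :
    eval x (substPoly A F) = eval (A *ᵥ x) F := by
  unfold substPoly
  induction F using MvPolynomial.induction_on with
  | C a => simp
  | add p q hp hq => simp only [map_add, hp, hq]
  | mul_X p k hp =>
    rw [map_mul, map_mul, hp, map_mul, aeval_X]
    simp [Matrix.mulVec, dotProduct, smul_eq_C_mul]

lemma IsNonsingular.substPoly {F : MvPolynomial (Fin 3) K} (hns : IsNonsingular F)
    (P : GL (Fin 3) K) : IsNonsingular (substPoly (P : Matrix (Fin 3) (Fin 3) K) F) := by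
  intro x hx
  have hinj := Matrix.mulVec_injective_of_isUnit P.isUnit
  have hinj' := Matrix.vecMul_injective_of_isUnit P.isUnit
  have h0 : (P : Matrix (Fin 3) (Fin 3) K) *ᵥ x = 0 := by
    apply hns
    have : (fun j => eval ((P : Matrix (Fin 3) (Fin 3) K) *ᵥ x) (pderiv j F)) ᵥ*
        (P : Matrix (Fin 3) (Fin 3) K) = 0 := by
      funext i
      have := hx i
      rw [pderiv_substPoly] at this
      simpa [smul_eq_C_mul, eval_substPoly, Matrix.vecMul, dotProduct, mul_comm] using this
    have h := hinj' (this.trans (Matrix.zero_vecMul _).symm)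
    exact fun i => congrFun h i
  exact hinj (h0.trans (Matrix.mulVec_zero _).symm)

lemma IsHomogeneous_substPoly {d : ℕ} {F : MvPolynomial (Fin 3) K} (h : F.IsHomogeneous d)
    (A : Matrix (Fin 3) (Fin 3) K) : (substPoly A F).IsHomogeneous d := by
  have := h.aeval (n := 1) (fun i => ∑ j, A i j • (X j : MvPolynomial (Fin 3) K)) (fun i => by
    apply IsHomogeneous.sum
    intro j _
    rw [smul_eq_C_mul]
    exact (isHomogeneous_X K j).C_mul _)
  rw [one_mul] at this
  exact this

/-- The diagonal torus in `GL₃`. -/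
def diagHom : (Fin 3 → Kˣ) →* GL (Fin 3) K :=
  (Units.map (Matrix.diagonalRingHom (Fin 3) K).toMonoidHom).comp
    (MulEquiv.piUnits (M := fun _ : Fin 3 => K)).symm.toMonoidHom

lemma diagHom_val (D : Fin 3 → Kˣ) :
    ((diagHom D : GL (Fin 3) K) : Matrix (Fin 3) (Fin 3) K)
      = Matrix.diagonal (fun i => (D i : K)) := rfl

lemma diagHom_mem_center (D : Fin 3 → Kˣ) :
    diagHom D ∈ Subgroup.center (GL (Fin 3) K) ↔ D 0 = D 1 ∧ D 0 = D 2 := by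
  rw [Matrix.GeneralLinearGroup.mem_center_iff_val_mem_range_scalar, diagHom_val]
  constructor
  · rintro ⟨a, ha⟩
    have h := fun i => congrFun (congrFun ha i) i
    simp at h
    exact ⟨Units.ext ((h 0).symm.trans (h 1)), Units.ext ((h 0).symm.trans (h 2))⟩
  · rintro ⟨h1, h2⟩
    refine ⟨D 0, ?_⟩
    rw [Matrix.scalar_apply]
    congr 1
    funext i
    fin_cases i
    · rfl
    · exact congrArg _ h1
    · exact congrArg _ h2

/-- A matrix of `GL₃` with a positive power central is diagonalizable. -/
lemma exists_diag [IsAlgClosed K] [CharZero K] (A : GL (Fin 3) K) (n : ℕ) (hn : 0 < n)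
    (h : A ^ n ∈ Subgroup.center (GL (Fin 3) K)) :
    ∃ (P : GL (Fin 3) K) (D : Fin 3 → Kˣ), A * P = P * diagHom D := by
  rw [Matrix.GeneralLinearGroup.center_eq_range_scalar] at h
  obtain ⟨c, hc⟩ := h
  set f : Module.End K (Fin 3 → K) := Matrix.toLin' (A : Matrix (Fin 3) (Fin 3) K) with hf
  have hss : f.IsSemisimple := by
    apply Module.End.isSemisimple_of_squarefree_aeval_eq_zero
      (p := Polynomial.X ^ n - Polynomial.C (c : K))
    · apply Polynomial.Separable.squarefree
      exact Polynomial.separable_X_pow_sub_C _ (by exact_mod_cast hn.ne') c.ne_zero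
    · have h1 := congrArg (fun g : GL (Fin 3) K => (g : Matrix (Fin 3) (Fin 3) K)) hc
      have h2 : f ^ n = Matrix.toLin' ((A : Matrix (Fin 3) (Fin 3) K) ^ n) := by
        rw [hf, Matrix.toLin'_pow]
      have h3 : (A : Matrix (Fin 3) (Fin 3) K) ^ n = Matrix.scalar (Fin 3) (c : K) := by
        simpa using h1.symm
      simp only [map_sub, map_pow, Polynomial.aeval_X, Polynomial.aeval_C]
      rw [h2, h3]
      apply LinearMap.ext
      intro v
      funext i
      simp [Module.algebraMap_end_apply]
  have htop := hss.iSup_eigenspace_eq_top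
  set s : Set (Fin 3 → K) := ⋃ μ : K, (f.eigenspace μ : Set (Fin 3 → K)) with hs
  have hspan : ⊤ ≤ Submodule.span K s := by
    rw [← htop]
    exact iSup_le fun μ x hx => Submodule.subset_span (Set.mem_iUnion.2 ⟨μ, hx⟩)
  let b := Module.Basis.ofSpan hspan
  have hb : ∀ i, b i ∈ s := fun i => Module.Basis.ofSpan_subset hspan ⟨i, rfl⟩
  obtain ⟨b', hb'⟩ : ∃ b' : Module.Basis (Fin 3) K (Fin 3 → K), ∀ i, b' i ∈ s :=
    ⟨b.reindex (b.indexEquiv (Pi.basisFun K (Fin 3))), fun i => by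
      rw [Module.Basis.reindex_apply]; exact hb _⟩
  have hex : ∀ i, ∃ μ : K, f (b' i) = μ • b' i := by
    intro i
    obtain ⟨μ, hμ⟩ := Set.mem_iUnion.1 (hb' i)
    exact ⟨μ, Module.End.mem_eigenspace_iff.1 hμ⟩
  choose μ hμ using hex
  have hinj := Matrix.mulVec_injective_of_isUnit A.isUnit
  have hμ0 : ∀ i, μ i ≠ 0 := by
    intro i h0
    have h1 := hμ i
    rw [h0, zero_smul, hf, Matrix.toLin'_apply] at h1
    exact b'.ne_zero i (hinj (h1.trans (Matrix.mulVec_zero _).symm))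
  let _ := (Pi.basisFun K (Fin 3)).invertibleToMatrix b'
  refine ⟨unitOfInvertible ((Pi.basisFun K (Fin 3)).toMatrix b'),
    fun i => Units.mk0 (μ i) (hμ0 i), ?_⟩
  apply Units.ext
  rw [Units.val_mul, Units.val_mul, diagHom_val]
  ext r s
  have h1 := congrFun (hμ s) r
  rw [hf, Matrix.toLin'_apply] at h1
  simpa [Matrix.mul_apply, Matrix.mulVec, dotProduct, Module.Basis.toMatrix_apply,
    Matrix.diagonal_apply, mul_comm (μ s)] using h1

/-! Weight computations in the (additively written) group of scalars. -/

/-- `H d a b e`: the projective order of `diag(a, b, e)` is a multiple of `d(d-2)`. -/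
def OrdCond {M : Type*} [AddCommGroup M] (d : ℤ) (a b e : M) : Prop :=
  ∀ n : ℤ, n • a = n • b → n • a = n • e → d * (d - 2) ∣ n

section Additive

variable {M : Type*} [AddCommGroup M] {d : ℤ} {a b e : M}

lemma not_dvd_aux (_hd : 4 ≤ d) {n : ℤ} (h0 : 0 < n) (h1 : n < d * (d - 2)) :
    ¬ d * (d - 2) ∣ n := fun h => by
  have := Int.le_of_dvd h0 h
  linarith

lemma case_fermat (hd : 4 ≤ d) (H : OrdCond d a b e) (h1 : (d - 1) • a + a = (d - 1) • b + b)
    (h2 : (d - 1) • a + a = (d - 1) • e + e) : False := by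
  have := H d (by linear_combination (norm := module) h1) (by linear_combination (norm := module) h2)
  exact not_dvd_aux hd (by linarith) (by nlinarith) this

lemma case_two (hd : 4 ≤ d) (H : OrdCond d a b e) (h1 : (d - 1) • a + a = (d - 1) • b + b)
    (h2 : (d - 1) • a + a = (d - 1) • e + b) : False := by
  have := H (d * (d - 1)) (by linear_combination (norm := module) (d - 1) • h1)
    (by linear_combination (norm := module) d • h2 - h1)
  have h3 : d * (d - 2) ∣ d := by
    have h4 := dvd_sub this (dvd_refl (d * (d - 2)))
    have h5 : d * (d - 1) - d * (d - 2) = d := by ring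
    rwa [h5] at h4
  exact not_dvd_aux hd (by linarith) (by nlinarith) h3

lemma case_star (hd : 4 ≤ d) (H : OrdCond d a b e) (h1 : (d - 1) • a + a = (d - 1) • b + a)
    (h2 : (d - 1) • a + a = (d - 1) • e + a) : False := by
  have := H (d - 1) (by linear_combination (norm := module) h1) (by linear_combination (norm := module) h2)
  exact not_dvd_aux hd (by linarith) (by nlinarith) this

lemma case_chain (hd : 4 ≤ d) (H : OrdCond d a b e) (h1 : (d - 1) • a + a = (d - 1) • b + a)
    (h2 : (d - 1) • a + a = (d - 1) • e + b) : False := by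
  have := H ((d - 1) * (d - 1)) (by linear_combination (norm := module) (d - 1) • h1)
    (by linear_combination (norm := module) (d - 1) • h2 - h1)
  have h3 : d * (d - 2) ∣ 1 := by
    have h4 := dvd_sub this (dvd_refl (d * (d - 2)))
    have h5 : (d - 1) * (d - 1) - d * (d - 2) = 1 := by ring
    rwa [h5] at h4
  exact not_dvd_aux hd (by linarith) (by nlinarith) h3

lemma case_cycle (hd : 4 ≤ d) (H : OrdCond d a b e) (h1 : (d - 1) • a + b = (d - 1) • b + e)
    (h2 : (d - 1) • a + b = (d - 1) • e + a) : False := by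
  have := H (d ^ 2 - 3 * d + 3)
    (by linear_combination (norm := module) (d - 1) • h1 - h2)
    (by linear_combination (norm := module) h1 + (d - 2) • h2)
  exact not_dvd_aux hd (by nlinarith) (by nlinarith) this

lemma case_tail (hd : 4 ≤ d) (H : OrdCond d a b e) (h1 : (d - 1) • a + b = (d - 1) • b + e)
    (h2 : (d - 1) • a + b = (d - 1) • e + b) : False := by
  have := H ((d - 1) * (d - 2))
    (by linear_combination (norm := module) (d - 1) • h1 - h2)
    (by linear_combination (norm := module) (d - 2) • h2)
  have h3 : d * (d - 2) ∣ d - 2 := by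
    have h4 := dvd_sub (dvd_refl (d * (d - 2))) this
    have h5 : d * (d - 2) - (d - 1) * (d - 2) = d - 2 := by ring
    rwa [h5] at h4
  exact not_dvd_aux hd (by linarith) (by nlinarith) h3

lemma case_good (hd : 4 ≤ d) (H : OrdCond d a b e) (h1 : (d - 1) • a + a = (d - 1) • b + e)
    {o p q : ℤ} (ho : 0 ≤ o) (hp : 0 ≤ p) (hq : 0 ≤ q) (hsum : o + p + q = d)
    (h3 : o • a + p • b + q • e = (d - 1) • a + a) :
    (o = d ∧ p = 0 ∧ q = 0) ∨ (o = 0 ∧ p = d - 1 ∧ q = 1) ∨ (o = 0 ∧ p = 1 ∧ q = d - 1) := by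
  obtain rfl : o = d - p - q := by linarith
  have key : (p - (d - 1) * q) • (b - a) = 0 := by
    linear_combination (norm := module) h3 + q • h1
  have key2 : e - a = -((d - 1) • (b - a)) := by
    linear_combination (norm := module) - h1
  have hdvd := H (p - (d - 1) * q) (by linear_combination (norm := module) - key)
    (by
      have : (p - (d - 1) * q) • (e - a) = 0 := by
        rw [key2]
        linear_combination (norm := module) (-(d - 1)) • key
      linear_combination (norm := module) - this)
  have hd1 : d ∣ p + q := by
    have h4 := dvd_add (dvd_trans (dvd_mul_right d (d - 2)) hdvd) (dvd_mul_right d q)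
    have h5 : p - (d - 1) * q + d * q = p + q := by ring
    rwa [h5] at h4
  obtain ⟨t, ht⟩ := hd1
  have ht0 : 0 ≤ t := by nlinarith
  have ht1 : t ≤ 1 := by nlinarith
  obtain rfl | rfl : t = 0 ∨ t = 1 := by omega
  · left
    refine ⟨?_, ?_, ?_⟩ <;> linarith
  · right
    obtain rfl : p = d - q := by linarith
    have h5 : d - q - (d - 1) * q = d * (1 - q) := by ring
    rw [h5] at hdvd
    obtain ⟨s, hs⟩ := (mul_dvd_mul_iff_left (by linarith : d ≠ 0)).1 hdvd
    have hs0 : s ≤ 0 := by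
      by_contra! h; nlinarith
    have hs1 : -1 ≤ s := by
      by_contra! h; nlinarith
    obtain rfl | rfl : s = 0 ∨ s = -1 := by omega
    · left; refine ⟨?_, ?_, ?_⟩ <;> linarith
    · right; refine ⟨?_, ?_, ?_⟩ <;> linarith

end Additive

/-- Classification of self-maps of a three-element set. -/
lemma fin3_classify (f : Fin 3 → Fin 3) : ∃ σ : Equiv.Perm (Fin 3),
    (f (σ 0) = σ 0 ∧ f (σ 1) = σ 2 ∧ f (σ 2) = σ 1) ∨
    (f (σ 0) = σ 0 ∧ f (σ 1) = σ 1 ∧ f (σ 2) = σ 2) ∨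
    (f (σ 0) = σ 0 ∧ f (σ 1) = σ 1 ∧ f (σ 2) = σ 1) ∨
    (f (σ 0) = σ 0 ∧ f (σ 1) = σ 0 ∧ f (σ 2) = σ 0) ∨
    (f (σ 0) = σ 0 ∧ f (σ 1) = σ 0 ∧ f (σ 2) = σ 1) ∨
    (f (σ 0) = σ 1 ∧ f (σ 1) = σ 2 ∧ f (σ 2) = σ 0) ∨
    (f (σ 0) = σ 1 ∧ f (σ 1) = σ 2 ∧ f (σ 2) = σ 1) := by
  revert f
  decide

lemma weight_aux {M : Type*} [AddCommGroup M] (a : Fin 3 → M) (i j : Fin 3) (n : ℕ) :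
    ∑ l, (((Finsupp.single i n + Finsupp.single j 1 : Fin 3 →₀ ℕ) l : ℕ) : ℤ) • a l
      = (n : ℤ) • a i + a j := by
  simp only [Finsupp.add_apply, Nat.cast_add, _root_.add_smul, Finset.sum_add_distrib]
  congr 1
  · rw [Finset.sum_eq_single i (by intro l _ hl; simp [hl]) (by simp)]
    rw [Finsupp.single_eq_same]
  · rw [Finset.sum_eq_single j (by intro l _ hl; simp [hl]) (by simp)]
    simp

/-- The three-term normal form can be rescaled. -/
lemma projEquiv_of_three [IsAlgClosed K] {d : ℕ} (hd : 4 ≤ d) (σ : Equiv.Perm (Fin 3))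
    {a b c : K} (ha : a ≠ 0) (hb : b ≠ 0) (hc : c ≠ 0) :
    ∃ M : GL (Fin 3) K, substPoly (M : Matrix (Fin 3) (Fin 3) K)
      (C a * X (σ 0) ^ d + C b * (X (σ 1) ^ (d - 1) * X (σ 2))
        + C c * (X (σ 1) * X (σ 2) ^ (d - 1)))
      = X 0 ^ d + X 1 ^ (d - 1) * X 2 + X 1 * X 2 ^ (d - 1) := by
  obtain ⟨α, hα⟩ := IsAlgClosed.exists_pow_nat_eq a⁻¹ (by omega : 0 < d)
  obtain ⟨r, hr⟩ := IsAlgClosed.exists_pow_nat_eq (c / b) (by omega : 0 < d - 2)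
  obtain ⟨γ, hγ⟩ := IsAlgClosed.exists_pow_nat_eq (b * r ^ (d - 1))⁻¹ (by omega : 0 < d)
  have hr0 : r ≠ 0 := by
    rintro rfl
    rw [zero_pow (by omega)] at hr
    exact div_ne_zero hc hb hr.symm
  have hα0 : α ≠ 0 := by
    rintro rfl
    rw [zero_pow (by omega)] at hα
    exact inv_ne_zero ha hα.symm
  have hγ0 : γ ≠ 0 := by
    rintro rfl
    rw [zero_pow (by omega)] at hγ
    exact inv_ne_zero (mul_ne_zero hb (pow_ne_zero _ hr0)) hγ.symm
  obtain ⟨k, rfl⟩ : ∃ k, d = k + 2 := ⟨d - 2, by omega⟩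
  have e1 : k + 2 - 1 = k + 1 := by omega
  have e2 : k + 2 - 2 = k := by omega
  rw [e1] at hγ ⊢
  rw [e2] at hr
  have q1 : a * α ^ (k + 2) = 1 := by rw [hα]; field_simp
  have q2 : b * ((r * γ) ^ (k + 1) * γ) = 1 := by
    have : b * ((r * γ) ^ (k + 1) * γ) = (b * r ^ (k + 1)) * γ ^ (k + 2) := by ring
    rw [this, hγ]
    exact mul_inv_cancel₀ (mul_ne_zero hb (pow_ne_zero _ hr0))
  have q3 : c * ((r * γ) * γ ^ (k + 1)) = 1 := by
    have hcb : c = b * r ^ k := by rw [hr]; field_simp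
    rw [← q2, hcb]; ring
  let v : Fin 3 → K := ![α, r * γ, γ]
  have hv : ∀ i, v i ≠ 0 := by
    intro i
    fin_cases i
    · exact hα0
    · exact mul_ne_zero hr0 hγ0
    · exact hγ0
  have hU : IsUnit ((Matrix.diagonal v).submatrix σ.symm (Equiv.refl _)) := by
    rw [Matrix.isUnit_submatrix_equiv, Matrix.isUnit_diagonal, Pi.isUnit_iff]
    exact fun i => (hv i).isUnit
  refine ⟨hU.unit, ?_⟩
  have hl : ∀ l, (∑ j, (hU.unit : Matrix (Fin 3) (Fin 3) K) (σ l) j •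
      (X j : MvPolynomial (Fin 3) K)) = C (v l) * X l := by
    intro l
    simp [Matrix.diagonal_apply, ite_smul, smul_eq_C_mul]
  unfold substPoly
  simp only [map_add, map_mul, map_pow, aeval_X, hl, aeval_C, algebraMap_eq]
  have v0 : v 0 = α := rfl
  have v1 : v 1 = r * γ := rfl
  have v2 : v 2 = γ := rfl
  rw [v0, v1, v2]
  have c1 := congrArg (C : K → MvPolynomial (Fin 3) K) q1
  have c2 := congrArg (C : K → MvPolynomial (Fin 3) K) q2
  have c3 := congrArg (C : K → MvPolynomial (Fin 3) K) q3
  simp only [map_mul, map_pow, map_one] at c1 c2 c3 ⊢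
  linear_combination (X 0 ^ (k + 2)) * c1 + (X 1 ^ (k + 1) * X 2) * c2
    + (X 1 * X 2 ^ (k + 1)) * c3

lemma eq_three {d : ℕ} (hd : 4 ≤ d) (σ : Equiv.Perm (Fin 3)) (F : MvPolynomial (Fin 3) K)
    (h : ∀ m, coeff m F ≠ 0 →
      (m (σ 0) = d ∧ m (σ 1) = 0 ∧ m (σ 2) = 0) ∨
      (m (σ 0) = 0 ∧ m (σ 1) = d - 1 ∧ m (σ 2) = 1) ∨
      (m (σ 0) = 0 ∧ m (σ 1) = 1 ∧ m (σ 2) = d - 1)) :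
    F = C (coeff (Finsupp.single (σ 0) (d - 1) + Finsupp.single (σ 0) 1) F) * X (σ 0) ^ d
      + C (coeff (Finsupp.single (σ 1) (d - 1) + Finsupp.single (σ 2) 1) F)
        * (X (σ 1) ^ (d - 1) * X (σ 2))
      + C (coeff (Finsupp.single (σ 2) (d - 1) + Finsupp.single (σ 1) 1) F)
        * (X (σ 1) * X (σ 2) ^ (d - 1)) := by
  set m1 := Finsupp.single (σ 0) (d - 1) + Finsupp.single (σ 0) 1 with hm1
  set m2 := Finsupp.single (σ 1) (d - 1) + Finsupp.single (σ 2) 1 with hm2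
  set m3 := Finsupp.single (σ 2) (d - 1) + Finsupp.single (σ 1) 1 with hm3
  have x1 : (X (σ 0) ^ d : MvPolynomial (Fin 3) K) = monomial m1 1 := by
    rw [hm1, ← Finsupp.single_add, X_pow_eq_monomial, Nat.sub_add_cancel (by omega)]
  have x2 : (X (σ 1) ^ (d - 1) * X (σ 2) : MvPolynomial (Fin 3) K) = monomial m2 1 := by
    rw [hm2, X_pow_eq_monomial, X, monomial_mul, one_mul]
  have x3 : (X (σ 1) * X (σ 2) ^ (d - 1) : MvPolynomial (Fin 3) K) = monomial m3 1 := by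
    rw [hm3, X_pow_eq_monomial, X, monomial_mul, one_mul, add_comm]
  have n01 : σ 0 ≠ σ 1 := by simp
  have n02 : σ 0 ≠ σ 2 := by simp
  have n12 : σ 1 ≠ σ 2 := by simp
  have v1 : m1 (σ 0) = d ∧ m1 (σ 1) = 0 ∧ m1 (σ 2) = 0 := by
    simp [hm1]; omega
  have v2 : m2 (σ 0) = 0 ∧ m2 (σ 1) = d - 1 ∧ m2 (σ 2) = 1 := by
    simp [hm2]
  have v3 : m3 (σ 0) = 0 ∧ m3 (σ 1) = 1 ∧ m3 (σ 2) = d - 1 := by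
    simp [hm3]
  have hext : ∀ m m' : Fin 3 →₀ ℕ, m (σ 0) = m' (σ 0) → m (σ 1) = m' (σ 1) →
      m (σ 2) = m' (σ 2) → m = m' := by
    intro m m' h0 h1 h2
    ext i
    obtain ⟨j, rfl⟩ := σ.surjective i
    fin_cases j
    · exact h0
    · exact h1
    · exact h2
  have d12 : m1 ≠ m2 := fun h => by rw [h] at v1; omega
  have d13 : m1 ≠ m3 := fun h => by rw [h] at v1; omega
  have d23 : m2 ≠ m3 := fun h => by rw [h] at v2; omega
  rw [x1, x2, x3]
  ext m
  simp only [coeff_add, coeff_C_mul, coeff_monomial]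
  by_cases hm : coeff m F = 0
  · rw [hm]
    have w : ∀ m', coeff m' F * (if m' = m then (1 : K) else 0) = 0 := by
      intro m'
      split_ifs with hmm
      · rw [hmm, hm, zero_mul]
      · rw [mul_zero]
    rw [w, w, w, add_zero, add_zero]
  · rcases h m hm with h | h | h
    · obtain rfl : m = m1 := hext _ _ (by omega) (by omega) (by omega)
      simp [d12.symm, d13.symm]
    · obtain rfl : m = m2 := hext _ _ (by omega) (by omega) (by omega)
      simp [d12, d23.symm]
    · obtain rfl : m = m3 := hext _ _ (by omega) (by omega) (by omega)
      simp [d13, d23]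

/-- Core of the forward direction: the diagonal case. -/
lemma diag_core [IsAlgClosed K] {d : ℕ} (hd : 4 ≤ d) {F : MvPolynomial (Fin 3) K}
    (hhom : F.IsHomogeneous d) (hns : IsNonsingular F) (D : Fin 3 → Kˣ) (c : Kˣ)
    (hD : substPoly (diagHom D : GL (Fin 3) K).1 F = (c : K) • F)
    (H : ∀ n : ℤ, (∀ i j, D i ^ n = D j ^ n) → (d : ℤ) * (d - 2) ∣ n) :
    ∃ M : GL (Fin 3) K, substPoly (M : Matrix (Fin 3) (Fin 3) K) F
      = X 0 ^ d + X 1 ^ (d - 1) * X 2 + X 1 * X 2 ^ (d - 1) := by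
  have hd' : (4 : ℤ) ≤ d := by exact_mod_cast hd
  let a : Fin 3 → Additive Kˣ := fun i => Additive.ofMul (D i)
  have hw : ∀ m, coeff m F ≠ 0 → ∑ i, (m i : ℤ) • a i = Additive.ofMul c := by
    intro m hm
    have h1 := congrArg (coeff m) hD
    rw [diagHom_val, coeff_substPoly_diagonal, coeff_smul, smul_eq_mul] at h1
    have h2 := mul_right_cancel₀ hm h1
    have h3 : ∏ i, D i ^ m i = c := by
      apply Units.ext
      simpa using h2
    rw [← h3, ofMul_prod]
    simp [a]
  choose f hf using exists_coeff_ne_zero hhom hns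
  have hfw : ∀ i, ((d : ℤ) - 1) • a i + a (f i) = Additive.ofMul c := by
    intro i
    rw [← hw _ (hf i)]
    have : ((d - 1 : ℕ) : ℤ) = (d : ℤ) - 1 := by omega
    rw [← this]
    exact (weight_aux a i (f i) (d - 1)).symm
  obtain ⟨σ, hσ⟩ := fin3_classify f
  have HO : OrdCond (d : ℤ) (a (σ 0)) (a (σ 1)) (a (σ 2)) := by
    intro n h1 h2
    have h1' : D (σ 0) ^ n = D (σ 1) ^ n := h1
    have h2' : D (σ 0) ^ n = D (σ 2) ^ n := h2
    apply H
    have : ∀ i, D i ^ n = D (σ 0) ^ n := by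
      intro i
      obtain ⟨j, rfl⟩ := σ.surjective i
      fin_cases j
      · rfl
      · exact h1'.symm
      · exact h2'.symm
    exact fun i j => (this i).trans (this j).symm
  have w0 := hfw (σ 0)
  have w1 := hfw (σ 1)
  have w2 := hfw (σ 2)
  have E1 := w0.trans w1.symm
  have E2 := w0.trans w2.symm
  rcases hσ with h | h | h | h | h | h | h <;> obtain ⟨s0, s1, s2⟩ := h <;>
    rw [s0, s1] at E1 <;> rw [s0, s2] at E2
  · have g0 := hf (σ 0)
    have g1 := hf (σ 1)
    have g2 := hf (σ 2)
    rw [s0] at g0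
    rw [s1] at g1
    rw [s2] at g2
    have hE := eq_three hd σ F (fun m hm => by
      have hsum := hw m hm
      rw [← Equiv.sum_comp σ, Fin.sum_univ_three, ← w0, s0] at hsum
      have hdeg : m.degree = d := by
        rw [Finsupp.degree_eq_weight_one]; exact hhom hm
      rw [Finsupp.degree_eq_sum, ← Equiv.sum_comp σ, Fin.sum_univ_three] at hdeg
      have := case_good hd' HO E1 (Int.natCast_nonneg (m (σ 0))) (Int.natCast_nonneg (m (σ 1)))
        (Int.natCast_nonneg (m (σ 2))) (by exact_mod_cast hdeg) hsum
      omega)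
    obtain ⟨M, hM⟩ := projEquiv_of_three hd σ g0 g1 g2
    exact ⟨M, by rw [hE]; exact hM⟩
  · exact (case_fermat hd' HO E1 E2).elim
  · exact (case_two hd' HO E1 E2).elim
  · exact (case_star hd' HO E1 E2).elim
  · exact (case_chain hd' HO E1 E2).elim
  · exact (case_cycle hd' HO E1 E2).elim
  · exact (case_tail hd' HO E1 E2).elim

lemma forward [IsAlgClosed K] [CharZero K] {d : ℕ} (hd : 4 ≤ d) {F : MvPolynomial (Fin 3) K}
    (hhom : F.IsHomogeneous d) (hns : IsNonsingular F)
    (h : ∃ g ∈ projAut F, orderOf g = d * (d - 2)) :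
    ProjEquiv F (X 0 ^ d + X 1 ^ (d - 1) * X 2 + X 1 * X 2 ^ (d - 1)) := by
  obtain ⟨g, ⟨A, ⟨c, hc⟩, rfl⟩, hord⟩ := h
  have hN : 0 < d * (d - 2) := Nat.mul_pos (by omega) (by omega)
  have hpow : A ^ (d * (d - 2)) ∈ Subgroup.center (GL (Fin 3) K) := by
    rw [← QuotientGroup.eq_one_iff]
    have := pow_orderOf_eq_one (QuotientGroup.mk' (Subgroup.center (GL (Fin 3) K)) A)
    rw [hord, ← map_pow] at this
    exact this
  obtain ⟨P, D, hPD⟩ := exists_diag A _ hN hpow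
  have hconj : A = P * diagHom D * P⁻¹ := by rw [← hPD]; group
  have hD : substPoly (diagHom D : GL (Fin 3) K).1 (substPoly P.1 F) = (c : K) • substPoly P.1 F := by
    rw [← substPoly_mul, ← Units.val_mul, ← hPD, Units.val_mul, substPoly_mul, hc, substPoly_smul]
  obtain ⟨M, hM⟩ := diag_core hd (IsHomogeneous_substPoly hhom P.1) (hns.substPoly P) D c hD (by
    intro n hn
    have h1 : (diagHom D : GL (Fin 3) K) ^ n ∈ Subgroup.center (GL (Fin 3) K) := by
      rw [← map_zpow, diagHom_mem_center]
      exact ⟨hn 0 1, hn 0 2⟩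
    have h2 : A ^ n ∈ Subgroup.center (GL (Fin 3) K) := by
      rw [hconj, conj_zpow]
      exact Subgroup.Normal.conj_mem inferInstance _ h1 P
    have h3 : (QuotientGroup.mk' (Subgroup.center (GL (Fin 3) K)) A) ^ n = 1 := by
      rw [← map_zpow]
      exact (QuotientGroup.eq_one_iff _).2 h2
    have h4 := orderOf_dvd_iff_zpow_eq_one.2 h3
    rw [hord] at h4
    have : ((d * (d - 2) : ℕ) : ℤ) = (d : ℤ) * (d - 2) := by
      rw [Nat.cast_mul, Nat.cast_sub (by omega)]; rfl
    rwa [this] at h4)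
  refine ⟨P * M, 1, ?_⟩
  rw [Units.val_mul, substPoly_mul, hM, Units.val_one, one_smul]

lemma backward [IsAlgClosed K] [CharZero K] {d : ℕ} (hd : 4 ≤ d) {F : MvPolynomial (Fin 3) K}
    (h : ProjEquiv F (X 0 ^ d + X 1 ^ (d - 1) * X 2 + X 1 * X 2 ^ (d - 1))) :
    ∃ g ∈ projAut F, orderOf g = d * (d - 2) := by
  obtain ⟨A, c, hA⟩ := h
  have hN : 0 < d * (d - 2) := Nat.mul_pos (by omega) (by omega)
  have : NeZero (d * (d - 2)) := ⟨hN.ne'⟩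
  have : NeZero ((d * (d - 2) : ℕ) : K) := ⟨by exact_mod_cast hN.ne'⟩
  obtain ⟨ζ, hζ⟩ := HasEnoughRootsOfUnity.exists_primitiveRoot K (d * (d - 2))
  obtain ⟨u, rfl⟩ := hζ.isUnit hN.ne'
  have hu : orderOf u = d * (d - 2) := by
    rw [← orderOf_units, ← hζ.eq_orderOf]
  let D : Fin 3 → Kˣ := ![1, u, (u ^ (d - 1))⁻¹]
  set G : MvPolynomial (Fin 3) K := X 0 ^ d + X 1 ^ (d - 1) * X 2 + X 1 * X 2 ^ (d - 1) with hG
  have hDG : substPoly (diagHom D : GL (Fin 3) K).1 G = G := by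
    have hl : ∀ l, (∑ j, (diagHom D : GL (Fin 3) K).1 l j •
        (X j : MvPolynomial (Fin 3) K)) = C (D l : K) * X l := by
      intro l
      simp [diagHom_val, Matrix.diagonal_apply, ite_smul, smul_eq_C_mul]
    have q1 : D 1 ^ (d - 1) * D 2 = 1 := mul_inv_cancel (u ^ (d - 1))
    have q2 : D 1 * D 2 ^ (d - 1) = 1 := by
      change u * ((u ^ (d - 1))⁻¹) ^ (d - 1) = 1
      rw [inv_pow, mul_inv_eq_one, ← pow_mul]
      obtain ⟨k, rfl⟩ : ∃ k, d = k + 2 := ⟨d - 2, by omega⟩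
      have e : (k + 2 - 1) * (k + 2 - 1) = (k + 2) * (k + 2 - 2) + 1 := by
        have e1 : k + 2 - 1 = k + 1 := by omega
        have e2 : k + 2 - 2 = k := by omega
        rw [e1, e2]; ring
      rw [e, pow_succ, ← hu, pow_orderOf_eq_one, one_mul]
    have c0 : (C (D 0 : K) : MvPolynomial (Fin 3) K) = 1 := by
      simp [D]
    have c1 := congrArg (fun z : Kˣ => (C (z : K) : MvPolynomial (Fin 3) K)) q1
    have c2 := congrArg (fun z : Kˣ => (C (z : K) : MvPolynomial (Fin 3) K)) q2
    simp only [Units.val_mul, Units.val_pow_eq_pow_val, map_mul, map_pow, Units.val_one,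
      map_one] at c1 c2
    rw [hG]
    unfold substPoly
    simp only [map_add, map_mul, map_pow, aeval_X, hl]
    rw [c0]
    linear_combination (X 1 ^ (d - 1) * X 2) * c1 + (X 1 * X 2 ^ (d - 1)) * c2
  have hB : A * diagHom D * A⁻¹ ∈ autGL F := by
    refine ⟨1, ?_⟩
    rw [Units.val_mul, Units.val_mul, substPoly_mul, substPoly_mul, hA, substPoly_smul, hDG, ← hA,
      ← substPoly_mul, ← Units.val_mul, mul_inv_cancel, Units.val_one, substPoly_one,
      Units.val_one, one_smul]
  refine ⟨_, ⟨_, hB, rfl⟩, ?_⟩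
  have hsc : SemiconjBy (QuotientGroup.mk' (Subgroup.center (GL (Fin 3) K)) A)
      (QuotientGroup.mk' (Subgroup.center (GL (Fin 3) K)) (diagHom D))
      (QuotientGroup.mk' (Subgroup.center (GL (Fin 3) K)) (A * diagHom D * A⁻¹)) := by
    unfold SemiconjBy
    rw [← map_mul, ← map_mul]
    congr 1
    group
  rw [← hsc.orderOf_eq, ← hu, orderOf_eq_orderOf_iff]
  intro n
  rw [← map_pow, ← map_pow]
  have h1 : QuotientGroup.mk' (Subgroup.center (GL (Fin 3) K)) (diagHom (D ^ n)) = 1 ↔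
      diagHom (D ^ n) ∈ Subgroup.center (GL (Fin 3) K) := QuotientGroup.eq_one_iff _
  rw [h1, diagHom_mem_center]
  constructor
  · rintro ⟨h, -⟩
    have : (1 : Kˣ) ^ n = u ^ n := h
    rw [← this, one_pow]
  · intro h
    refine ⟨?_, ?_⟩
    · change (1 : Kˣ) ^ n = u ^ n
      rw [h, one_pow]
    · change (1 : Kˣ) ^ n = ((u ^ (d - 1))⁻¹) ^ n
      rw [inv_pow, ← pow_mul, mul_comm, pow_mul, h, one_pow, one_pow, inv_one]

end Helpers

/-- a nonsingular plane curve of degree `d ≥ 4` has an automorphism of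
order `d(d-2)` iff it is projectively equivalent to `X^d + Y^(d-1)·Z + Y·Z^(d-1)`. -/
theorem stmt5 {K : Type*} [Field K] [IsAlgClosed K] [CharZero K]
    (d : ℕ) (hd : 4 ≤ d) (F : MvPolynomial (Fin 3) K)
    (hhom : F.IsHomogeneous d) (hns : IsNonsingular F) :
    (∃ g ∈ projAut F, orderOf g = d * (d - 2)) ↔
      ProjEquiv F (X 0 ^ d + X 1 ^ (d - 1) * X 2 + X 1 * X 2 ^ (d - 1)) := by
  exact ⟨forward hd hhom hns, backward hd⟩

end
end

section
/- Let K be an algebraically closed field of characteristic 0, let d ≥ 5, and let α ∈ K^×. The automorphism group of the nonsingular plane curve defined by F = X^{d−1}·Y + Y^{d−1}·Z + α·Z^{d−1}·X is isomorphic to the group with presentation ⟨τ, σ ∣ τ^{d²−3d+3} = σ³ = 1, τσ = στ^{−(d−1)}⟩; in particular Aut(F) has order 3(d²−3d+3), and it contains an element τ of order d²−3d+3 and an element σ of order 3 with τσ = στ^{−(d−1)}. -/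
open MvPolynomial Matrix

noncomputable section

variable {K : Type*} [Field K]

/-- The relations of the presentation
`⟨τ, σ ∣ τ^(d²-3d+3) = σ³ = 1, τσ = στ^(-(d-1))⟩`,
with `σ = FreeGroup.of true` and `τ = FreeGroup.of false`. -/
def rels6 (d : ℕ) : Set (FreeGroup Bool) :=
  {FreeGroup.of true ^ 3, FreeGroup.of false ^ (d * d - 3 * d + 3),
    (FreeGroup.of true)⁻¹ * FreeGroup.of false * FreeGroup.of true *
      FreeGroup.of false ^ (d - 1)}

lemma kc_chain (A : Matrix (Fin 3) (Fin 3) K) (G : MvPolynomial (Fin 3) K) (j : Fin 3) :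
    pderiv j (substPoly A G) = ∑ i, C (A i j) * substPoly A (pderiv i G) := by
  have hlin : ∀ i, pderiv j (∑ l, A i l • (X l : MvPolynomial (Fin 3) K)) = C (A i j) := by
    intro i
    rw [map_sum]
    simp [pderiv_X, Pi.single_apply, MvPolynomial.smul_eq_C_mul]
  induction G using MvPolynomial.induction_on with
  | C a => simp [substPoly]
  | add p q hp hq =>
    have hs : ∀ p q : MvPolynomial (Fin 3) K, substPoly A (p + q) = substPoly A p + substPoly A q :=
      fun p q => by simp [substPoly]
    simp only [hs, map_add, hp, hq, mul_add, Finset.sum_add_distrib]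
  | mul_X p i hp =>
    have hs : ∀ p q : MvPolynomial (Fin 3) K, substPoly A (p * q) = substPoly A p * substPoly A q :=
      fun p q => by simp [substPoly]
    have ha : ∀ p q : MvPolynomial (Fin 3) K, substPoly A (p + q) = substPoly A p + substPoly A q :=
      fun p q => by simp [substPoly]
    have hX : substPoly A (X i) = ∑ l, A i l • (X l : MvPolynomial (Fin 3) K) := by
      simp [substPoly]
    have h1 : ∀ l, substPoly A (pderiv l (X i : MvPolynomial (Fin 3) K)) = if l = i then 1 else 0 := by
      intro l
      by_cases h : l = i
      · subst h; simp [substPoly]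
      · simp [substPoly, pderiv_X_of_ne (Ne.symm h), h]
    rw [hs, Derivation.leibniz, hp, hX, hlin]
    clear hp hlin
    simp only [Derivation.leibniz, smul_eq_mul, ha, hs, h1, hX]
    generalize ∑ l, A i l • (X l : MvPolynomial (Fin 3) K) = L
    simp only [Fin.sum_univ_three]
    fin_cases i <;> simp <;> ring

lemma kc_chain_inv (A B : Matrix (Fin 3) (Fin 3) K) (hAB : A * B = 1)
    (G : MvPolynomial (Fin 3) K) (i : Fin 3) :
    substPoly A (pderiv i G) = ∑ j, C (B j i) * pderiv j (substPoly A G) := by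
  simp only [kc_chain, Finset.mul_sum]
  rw [Finset.sum_comm]
  have : ∀ k, ∑ j, C (B j i) * (C (A k j) * substPoly A (pderiv k G))
      = C ((A * B) k i) * substPoly A (pderiv k G) := by
    intro k
    rw [Matrix.mul_apply, map_sum, Finset.sum_mul]
    exact Finset.sum_congr rfl fun j _ => by rw [C_mul]; ring
  simp only [this, hAB, Matrix.one_apply]
  simp

/-- third derivatives of an invariant form, in terms of those of the form -/
lemma kc_third (A B : Matrix (Fin 3) (Fin 3) K) (hAB : A * B = 1)
    (F : MvPolynomial (Fin 3) K) (c : K) (hF : substPoly A F = c • F) (r : Fin 3)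
    (v : Fin 3 → K) (hv : ∀ j k, eval v (pderiv r (pderiv j (pderiv k F))) = 0) (a b : Fin 3) :
    eval v (pderiv r (substPoly A (pderiv a (pderiv b F)))) = 0 := by
  rw [kc_chain_inv A B hAB, kc_chain_inv A B hAB, hF]
  simp [map_sum, MvPolynomial.smul_eq_C_mul, Derivation.leibniz, hv]

/-- the curve -/
def kcF (e : ℕ) (α : K) : MvPolynomial (Fin 3) K :=
  X 0 ^ e * X 1 + X 1 ^ e * X 2 + C α * X 2 ^ e * X 0

lemma kc_eval_subst (A : Matrix (Fin 3) (Fin 3) K) (G : MvPolynomial (Fin 3) K) (v : Fin 3 → K) :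
    eval v (substPoly A G) = eval (A *ᵥ v) G := by
  induction G using MvPolynomial.induction_on with
  | C a => simp [substPoly]
  | add p q hp hq => simp only [substPoly, map_add] at *; rw [hp, hq]
  | mul_X p i hp =>
    simp only [substPoly, map_mul] at *
    rw [hp]
    simp [Matrix.mulVec, dotProduct, MvPolynomial.smul_eval]

lemma kc_pd (s : Fin 3) : pderiv s (4 : MvPolynomial (Fin 3) K) = 0 := by
  have h := (pderiv s : Derivation K (MvPolynomial (Fin 3) K) (MvPolynomial (Fin 3) K)).map_natCast 4
  exact_mod_cast h

lemma kc_C4 : (C 4 : MvPolynomial (Fin 3) K) = 4 := map_ofNat C 4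

lemma kc_vanish (k : ℕ) (α : K) (j l : Fin 3) :
    eval ![0,1,0] (pderiv 0 (pderiv j (pderiv l (kcF (k+4) α)))) = 0 ∧
    eval ![0,0,1] (pderiv 1 (pderiv j (pderiv l (kcF (k+4) α)))) = 0 ∧
    eval ![1,0,0] (pderiv 2 (pderiv j (pderiv l (kcF (k+4) α)))) = 0 := by
  fin_cases j <;> fin_cases l <;>
  simp [kcF, Derivation.leibniz, Derivation.leibniz_pow, kc_pd]

lemma kc_row [CharZero K] (k : ℕ) (α : K) (hα : α ≠ 0) (A B : Matrix (Fin 3) (Fin 3) K)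
    (hAB : A * B = 1) (c : K) (hF : substPoly A (kcF (k+4) α) = c • kcF (k+4) α) (i : Fin 3) :
    A i 0 * A i 1 = 0 ∧ A i 1 * A i 2 = 0 ∧ A i 2 * A i 0 = 0 := by
  have h0 := kc_third A B hAB _ c hF 0 _ (fun j l => (kc_vanish k α j l).1)
  have h1 := kc_third A B hAB _ c hF 1 _ (fun j l => (kc_vanish k α j l).2.1)
  have h2 := kc_third A B hAB _ c hF 2 _ (fun j l => (kc_vanish k α j l).2.2)
  have hne : ((k : K) + 4) ≠ 0 := by exact_mod_cast (by omega : k + 4 ≠ 0)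
  have hne3 : ((k : K) + 3) ≠ 0 := by exact_mod_cast (by omega : k + 3 ≠ 0)
  have key : ∃ β : K, β ≠ 0 ∧ ∃ a b, pderiv a (pderiv b (kcF (k+4) α)) = C β * X i ^ (k+3) := by
    fin_cases i
    · refine ⟨k+4, hne, 1, 0, ?_⟩
      simp [kcF, Derivation.leibniz, Derivation.leibniz_pow, kc_pd, kc_C4]
    · refine ⟨k+4, hne, 2, 1, ?_⟩
      simp [kcF, Derivation.leibniz, Derivation.leibniz_pow, kc_pd, kc_C4]
    · refine ⟨α * (k+4), mul_ne_zero hα hne, 0, 2, ?_⟩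
      simp [kcF, Derivation.leibniz, Derivation.leibniz_pow, kc_pd, kc_C4]
      ring
  obtain ⟨β, hβ, a, b, hab⟩ := key
  have h0 := h0 a b
  have h1 := h1 a b
  have h2 := h2 a b
  rw [hab] at h0 h1 h2
  simp [substPoly, Fin.sum_univ_three, Derivation.leibniz, Derivation.leibniz_pow,
    MvPolynomial.smul_eq_C_mul, hβ, hne3] at h0 h1 h2
  refine ⟨?_, ?_, ?_⟩ <;> grind

lemma kc_mk_eq (A B : GL (Fin 3) K) :
    ((A : PGL3 K) = (B : PGL3 K)) ↔
      ∃ c : K, c ≠ 0 ∧ (A : Matrix (Fin 3) (Fin 3) K) = c • (B : Matrix (Fin 3) (Fin 3) K) := by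
  rw [eq_comm, QuotientGroup.eq, Matrix.GeneralLinearGroup.mem_center_iff_val_mem_range_scalar]
  constructor
  · rintro ⟨c, hc⟩
    have h : (A : Matrix (Fin 3) (Fin 3) K) = c • (B : Matrix (Fin 3) (Fin 3) K) := by
      have h1 : (A : Matrix (Fin 3) (Fin 3) K) = (B : Matrix (Fin 3) (Fin 3) K) *
          ((B⁻¹ * A : GL (Fin 3) K) : Matrix (Fin 3) (Fin 3) K) := by
        rw [← Units.val_mul, mul_inv_cancel_left]
      rw [h1, ← hc]
      simp [Matrix.scalar_apply, ← Matrix.smul_eq_mul_diagonal]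
    refine ⟨c, ?_, h⟩
    rintro rfl
    have h2 := A.isUnit
    rw [h, zero_smul] at h2
    exact not_isUnit_zero h2
  · rintro ⟨c, hc, h⟩
    refine ⟨c, ?_⟩
    have h1 : ((B⁻¹ * A : GL (Fin 3) K) : Matrix (Fin 3) (Fin 3) K)
        = ((B⁻¹ : GL (Fin 3) K) : Matrix (Fin 3) (Fin 3) K) * (A : Matrix (Fin 3) (Fin 3) K) := rfl
    rw [h1, h, Matrix.mul_smul, ← Units.val_mul, inv_mul_cancel]
    simp [Matrix.scalar_apply, Matrix.smul_one_eq_diagonal]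

lemma kc_eval (e : ℕ) (α : K) (v : Fin 3 → K) :
    eval v (kcF e α) = v 0 ^ e * v 1 + v 1 ^ e * v 2 + α * v 2 ^ e * v 0 := by
  simp [kcF]

lemma kc_mem_of [CharZero K] (e : ℕ) (α : K) (A : GL (Fin 3) K) (c : K) (hc : c ≠ 0)
    (h : ∀ v, eval ((A : Matrix (Fin 3) (Fin 3) K) *ᵥ v) (kcF e α) = c * eval v (kcF e α)) :
    A ∈ autGL (kcF e α) := by
  refine ⟨Units.mk0 c hc, MvPolynomial.funext fun v => ?_⟩
  rw [kc_eval_subst, h]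
  simp [MvPolynomial.smul_eval]

/-- diagonal automorphism -/
def kcD (e : ℕ) (w : Kˣ) : GL (Fin 3) K :=
  Matrix.GeneralLinearGroup.mkOfDetNeZero (diagonal ![(w : K) ^ e, (w : K), 1]) (by
    simp [Fin.prod_univ_three])

/-- cyclic automorphism -/
def kcS (e : ℕ) (t : Kˣ) : GL (Fin 3) K :=
  Matrix.GeneralLinearGroup.mkOfDetNeZero
    !![0, 0, (t : K) ^ (2 * e - 1); (t : K) ^ (e + 1), 0, 0; 0, 1, 0] (by
    simp [Matrix.det_fin_three])

lemma kcD_val (e : ℕ) (w : Kˣ) : (kcD e w : Matrix (Fin 3) (Fin 3) K)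
    = diagonal ![(w : K) ^ e, (w : K), 1] := rfl

lemma kcS_val (e : ℕ) (t : Kˣ) : (kcS e t : Matrix (Fin 3) (Fin 3) K)
    = !![0, 0, (t : K) ^ (2 * e - 1); (t : K) ^ (e + 1), 0, 0; 0, 1, 0] := rfl

lemma kcD_mul (e : ℕ) (w w' : Kˣ) : kcD e w * kcD e w' = kcD e (w * w') := by
  ext i j
  rw [Units.val_mul, kcD_val, kcD_val, kcD_val, Matrix.diagonal_mul_diagonal]
  congr 2
  funext i
  fin_cases i <;> simp [mul_pow]

/-- diagonal automorphisms as a homomorphism to `PGL3` -/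
def kcDhom (K : Type*) [Field K] (e : ℕ) : Kˣ →* PGL3 K where
  toFun w := (kcD e w : PGL3 K)
  map_one' := by
    have : kcD e (1 : Kˣ) = 1 := by
      have h := kcD_mul e (1 : Kˣ) 1
      rw [one_mul] at h
      exact mul_eq_left.mp h
    rw [this]; rfl
  map_mul' w w' := by rw [← kcD_mul]; rfl

lemma kcDhom_inj (e : ℕ) : Function.Injective (kcDhom K e) := by
  intro w w' h
  obtain ⟨c, hc, h⟩ := (kc_mk_eq (kcD e w) (kcD e w')).1 h
  rw [kcD_val, kcD_val] at h
  have h1 := congrFun (congrFun h 1) 1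
  have h2 := congrFun (congrFun h 2) 2
  simp at h1 h2
  rw [← h2, one_mul] at h1
  exact Units.ext h1

lemma kcD_mem [CharZero K] (e n : ℕ) (hn : n + e = e * e + 1) (α : K) (w : Kˣ) (hw : w ^ n = 1) :
    kcD e w ∈ autGL (kcF e α) := by
  refine kc_mem_of e α _ ((w : K) ^ e) (by simp) fun v => ?_
  have h : ((w : K) ^ e) ^ e * w = (w : K) ^ e := by
    rw [← pow_mul, ← pow_succ, ← hn, pow_add]
    have : (w : K) ^ n = 1 := by rw [← Units.val_pow_eq_pow_val, hw, Units.val_one]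
    rw [this, one_mul]
  rw [kc_eval, kc_eval, kcD_val]
  simp only [Matrix.mulVec_diagonal]
  simp [mul_pow]
  linear_combination (v 0 ^ e * v 1) * h

lemma kcS_mem [CharZero K] (e n : ℕ) (he : 4 ≤ e) (hn : n + e = e * e + 1) (t : Kˣ) :
    kcS e t ∈ autGL (kcF e ((t : K) ^ n)) := by
  refine kc_mem_of e _ _ ((t : K) ^ (e * e + e)) (by simp) fun v => ?_
  have h1 : ((t : K) ^ (2 * e - 1)) ^ e * (t : K) ^ (e + 1) = (t : K) ^ (e * e + e) * (t : K) ^ n := by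
    rw [← pow_mul, ← pow_add, ← pow_add]
    congr 1
    obtain ⟨k, rfl⟩ := Nat.exists_eq_add_of_le he
    have : 2 * (4 + k) - 1 = 7 + 2 * k := by omega
    rw [this]
    nlinarith
  have h2 : (t : K) ^ n * (t : K) ^ (2 * e - 1) = (t : K) ^ (e * e + e) := by
    rw [← pow_add]
    congr 1
    omega
  have h3 : ((t : K) ^ (e + 1)) ^ e = (t : K) ^ (e * e + e) := by
    rw [← pow_mul]; congr 1; ring
  rw [kc_eval, kc_eval, kcS_val]
  simp [Matrix.mulVec, dotProduct, Fin.sum_univ_three, mul_pow]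
  linear_combination (v 2 ^ e * v 0) * h1 + (v 1 ^ e * v 2) * h2 + (v 0 ^ e * v 1) * h3

lemma kcS_cube (e : ℕ) (t : Kˣ) : (kcS e t : PGL3 K) ^ 3 = 1 := by
  have : ((kcS e t ^ 3 : GL (Fin 3) K) : PGL3 K) = ((1 : GL (Fin 3) K) : PGL3 K) := by
    rw [kc_mk_eq]
    refine ⟨(t : K) ^ (2 * e - 1) * (t : K) ^ (e + 1), by simp, ?_⟩
    rw [pow_three, Units.val_mul, Units.val_mul, kcS_val]
    ext i j
    fin_cases i <;> fin_cases j <;> simp [Matrix.mul_apply, Fin.sum_univ_three, mul_comm]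
  exact this

lemma kcS_conj (e n : ℕ) (hn : n + e = e * e + 1) (t w : Kˣ) (hw : w ^ n = 1) :
    (kcD e w : PGL3 K) * (kcS e t : PGL3 K) = (kcS e t : PGL3 K) * (kcDhom K e w) ^ (-(e : ℤ)) := by
  rw [_root_.zpow_neg, zpow_natCast, ← map_pow, ← map_inv]
  change ((kcD e w * kcS e t : GL (Fin 3) K) : PGL3 K) =
    ((kcS e t * kcD e (w ^ e)⁻¹ : GL (Fin 3) K) : PGL3 K)
  rw [kc_mk_eq]
  refine ⟨(w : K) ^ e, by simp, ?_⟩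
  have h : (w : K) = (w : K) ^ e * (((w : K) ^ e) ^ e)⁻¹ := by
    have h : ((w : K) ^ e) ^ e * w = (w : K) ^ e := by
      rw [← pow_mul, ← pow_succ, ← hn, pow_add]
      have : (w : K) ^ n = 1 := by rw [← Units.val_pow_eq_pow_val, hw, Units.val_one]
      rw [this, one_mul]
    field_simp
    linear_combination h
  have hne : (w : K) ≠ 0 := w.ne_zero
  rw [Units.val_mul, Units.val_mul, kcD_val, kcD_val, kcS_val]
  ext i j
  rw [Matrix.diagonal_mul, Matrix.smul_apply, Matrix.mul_diagonal]
  fin_cases i <;> fin_cases j <;> simp [hne]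
  linear_combination ((t : K) ^ (e + 1)) * h

lemma kcS_ne (e : ℕ) (t w : Kˣ) : (kcS e t : PGL3 K) ≠ kcDhom K e w := by
  intro h
  obtain ⟨c, hc, h⟩ := (kc_mk_eq (kcS e t) (kcD e w)).1 h
  rw [kcD_val, kcS_val] at h
  have h1 := congrFun (congrFun h 2) 1
  simp at h1

lemma kc_diag [CharZero K] (k n : ℕ) (hn : n + (k + 4) = (k + 4) * (k + 4) + 1) (α : K) (hα : α ≠ 0)
    (A : GL (Fin 3) K) (hA : A ∈ autGL (kcF (k + 4) α))
    (h00 : (A : Matrix (Fin 3) (Fin 3) K) 0 0 ≠ 0) :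
    ∃ w : Kˣ, w ^ n = 1 ∧ (A : PGL3 K) = kcDhom K (k + 4) w := by
  obtain ⟨c, hc⟩ := hA
  have hrow := kc_row k α hα A ((A⁻¹ : GL (Fin 3) K) : Matrix (Fin 3) (Fin 3) K)
    (by rw [← Units.val_mul, mul_inv_cancel]; rfl) c hc
  have hdet : (A : Matrix (Fin 3) (Fin 3) K).det ≠ 0 :=
    ((Matrix.isUnit_iff_isUnit_det _).1 A.isUnit).ne_zero
  have hev : ∀ v, eval ((A : Matrix (Fin 3) (Fin 3) K) *ᵥ v) (kcF (k + 4) α)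
      = c * eval v (kcF (k + 4) α) := by
    intro v
    rw [← kc_eval_subst, hc]
    simp [MvPolynomial.smul_eval]
  have hc0 : (c : K) ≠ 0 := c.ne_zero
  have hw0 : (A : Matrix (Fin 3) (Fin 3) K) = A := rfl
  generalize hM : (A : Matrix (Fin 3) (Fin 3) K) = M at *
  obtain ⟨r01, r02, r03⟩ := hrow 0
  obtain ⟨r11, r12, r13⟩ := hrow 1
  obtain ⟨r21, r22, r23⟩ := hrow 2
  rw [Matrix.det_fin_three] at hdet
  have z01 : M 0 1 = 0 := by simpa [h00] using r01
  have z02 : M 0 2 = 0 := by simpa [h00] using r03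
  rw [z01, z02] at hdet
  have z10 : M 1 0 = 0 := by
    by_contra h
    have h1 : M 1 1 = 0 := by simpa [h] using r11
    have h2 : M 1 2 = 0 := by simpa [h] using r13
    apply hdet; rw [h1, h2]; ring
  have z20 : M 2 0 = 0 := by
    by_contra h
    have h1 : M 2 1 = 0 := by simpa [h] using r21
    have h2 : M 2 2 = 0 := by simpa [h] using r23
    apply hdet; rw [h1, h2]; ring
  have e1 := hev ![1, 1, 0]
  have e2 := hev ![0, 1, 1]
  have e3 := hev ![1, 0, 1]
  have e4 := hev ![1, 0, 2]
  simp only [kc_eval] at e1 e2 e3 e4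
  simp [Matrix.mulVec, dotProduct, Fin.sum_univ_three, z01, z02, z10, z20] at e1 e2 e3 e4
  have n11 : M 1 1 ≠ 0 := by
    intro h
    have h12 : M 1 2 ≠ 0 := by
      intro h'; apply hdet; rw [h, h', z10]; ring
    have h21 : M 2 1 ≠ 0 := by
      intro h'; apply hdet; rw [h, h', z20]; ring
    have h22 : M 2 2 = 0 := by simpa [h21] using r22
    simp [h22] at e3 e4
    have h5 : (c : K) * α * (2 ^ (k + 4) - 2) = 0 := by linear_combination 2 * e3 - e4
    have h6 : (2 : K) ^ (k + 4) - 2 ≠ 0 := by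
      rw [sub_ne_zero]
      have : (2 : ℕ) ^ (k + 4) ≠ 2 := by
        have := Nat.one_le_two_pow (n := k)
        rw [pow_add]; omega
      exact_mod_cast this
    simp [hα, h6] at h5
  have z12 : M 1 2 = 0 := by simpa [n11] using r12
  have n22 : M 2 2 ≠ 0 := by
    intro h
    apply hdet; rw [h, z12]; ring
  have z21 : M 2 1 = 0 := by simpa [n22] using r22
  simp [z12, z21] at e1 e2 e3
  -- now diagonal
  have e3' : M 2 2 ^ (k + 4) * M 0 0 = c := by
    apply mul_left_cancel₀ hα
    linear_combination e3
  have u1 : (M 1 1 / M 2 2) ^ (k + 4) = M 0 0 / M 2 2 := by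
    rw [div_pow, div_eq_div_iff (by positivity) n22]
    linear_combination e2 - e3'
  have u2 : (M 0 0 / M 2 2) ^ (k + 4) * (M 1 1 / M 2 2) = M 0 0 / M 2 2 := by
    rw [div_pow, div_mul_div_comm, div_eq_div_iff (by positivity) n22]
    linear_combination M 2 2 * (e1 - e3')
  have w0 : M 1 1 / M 2 2 ≠ 0 := div_ne_zero n11 n22
  refine ⟨Units.mk0 _ w0, ?_, ?_⟩
  · ext
    rw [← u1, ← pow_mul, ← pow_succ, ← hn, pow_add] at u2
    have : (M 1 1 / M 2 2) ^ (k + 4) ≠ 0 := pow_ne_zero _ w0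
    simpa [w0] using u2
  · refine (kc_mk_eq A (kcD (k + 4) (Units.mk0 _ w0))).2 ⟨M 2 2, n22, ?_⟩
    rw [hM, kcD_val, Units.val_mk0, u1]
    ext i j
    fin_cases i <;> fin_cases j <;> simp [*] <;> field_simp

lemma kc_classify [CharZero K] (k n : ℕ) (hn : n + (k + 4) = (k + 4) * (k + 4) + 1) (t : Kˣ)
    (A : GL (Fin 3) K) (hA : A ∈ autGL (kcF (k + 4) ((t : K) ^ n))) :
    ∃ i : ℕ, ∃ w : Kˣ, w ^ n = 1 ∧ (A : PGL3 K) * (kcS (k + 4) t : PGL3 K) ^ i = kcDhom K (k + 4) w := by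
  have hS := kcS_mem (k + 4) n (by omega) hn t
  have key : ∃ i : ℕ, ((A * kcS (k + 4) t ^ i : GL (Fin 3) K) : Matrix (Fin 3) (Fin 3) K) 0 0 ≠ 0 := by
    by_contra hcon
    push Not at hcon
    have h0 := hcon 0
    have h1 := hcon 1
    have h2 := hcon 2
    rw [pow_zero, mul_one] at h0
    rw [pow_one, Units.val_mul, kcS_val] at h1
    rw [pow_two, Units.val_mul, Units.val_mul, kcS_val] at h2
    simp [Matrix.mul_apply, Fin.sum_univ_three] at h1 h2
    have hdet : (A : Matrix (Fin 3) (Fin 3) K).det ≠ 0 :=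
      ((Matrix.isUnit_iff_isUnit_det _).1 A.isUnit).ne_zero
    apply hdet
    rw [Matrix.det_fin_three, h0, h1, h2]
    ring
  obtain ⟨i, hi⟩ := key
  obtain ⟨w, hw, h⟩ := kc_diag k n hn _ (by simp) _ (mul_mem hA (pow_mem hS i)) hi
  exact ⟨i, w, hw, h⟩

lemma kc_swap {G : Type*} [Group G] (e : ℕ) (τ σ : G) (hrel : σ⁻¹ * τ * σ * τ ^ e = 1)
    (i : ℕ) (k : ℤ) : (σ ^ i)⁻¹ * τ ^ k = τ ^ ((-(e : ℤ)) ^ i * k) * (σ ^ i)⁻¹ := by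
  have h1 : σ⁻¹ * τ * σ = τ ^ (-(e : ℤ)) := by
    rw [_root_.zpow_neg, zpow_natCast]
    exact eq_inv_of_mul_eq_one_left hrel
  have h2 : ∀ k : ℤ, σ⁻¹ * τ ^ k = τ ^ (-(e : ℤ) * k) * σ⁻¹ := by
    intro k
    have h3 : σ⁻¹ * τ ^ k * σ = (σ⁻¹ * τ * σ) ^ k := by
      have := conj_zpow (i := k) (a := σ⁻¹) (b := τ)
      rw [inv_inv] at this
      exact this.symm
    rw [h1, ← _root_.zpow_mul] at h3
    rw [← h3]; group
  induction i with
  | zero => simp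
  | succ i ih =>
    rw [pow_succ, _root_.mul_inv_rev, mul_assoc, ih, ← mul_assoc, h2, mul_assoc]
    congr 2
    ring

lemma kc_red {G : Type*} [Group G] (n : ℕ) (hn : 0 < n) (τ σ : G) (hτ : τ ^ n = 1) (hσ : σ ^ 3 = 1)
    (j : ℤ) (i : ℕ) : ∃ p : Fin n × Fin 3, τ ^ (p.1 : ℕ) * (σ ^ (p.2 : ℕ))⁻¹ = τ ^ j * (σ ^ i)⁻¹ := by
  have hn' : (n : ℤ) ≠ 0 := by exact_mod_cast hn.ne'
  refine ⟨(⟨(j % n).toNat, ?_⟩, ⟨i % 3, Nat.mod_lt _ (by norm_num)⟩), ?_⟩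
  · have h1 := Int.emod_nonneg j hn'
    have h2 := Int.emod_lt_of_pos j (by exact_mod_cast hn : (0 : ℤ) < n)
    omega
  · congr 1
    · rw [← zpow_natCast]
      simp only [Int.toNat_of_nonneg (Int.emod_nonneg j hn')]
      conv_rhs => rw [← Int.emod_add_mul_ediv j n, _root_.zpow_add, _root_.zpow_mul, zpow_natCast, hτ]
      simp
    · congr 1
      conv_rhs => rw [← Nat.mod_add_div i 3, pow_add, pow_mul, hσ]
      simp

theorem kc_abs {G : Type*} [Group G] (d n : ℕ) (hn : n = d * d - 3 * d + 3) (τ σ : G)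
    (hσ : σ ^ 3 = 1) (hτ : orderOf τ = n) (hrel : σ⁻¹ * τ * σ * τ ^ (d - 1) = 1)
    (hne : ∀ j : ℤ, σ ≠ τ ^ j) (hgen : ∀ g : G, ∃ i : ℕ, ∃ j : ℤ, g * σ ^ i = τ ^ j) :
    Nonempty (G ≃* PresentedGroup (rels6 d)) ∧ Nat.card G = 3 * n := by
  have hn0 : 0 < n := by omega
  have hτn : τ ^ n = 1 := by rw [← hτ]; exact pow_orderOf_eq_one τ
  let f : Bool → G := fun b => if b then σ else τ
  have hf : ∀ r ∈ rels6 d, FreeGroup.lift f r = 1 := by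
    intro r hr
    simp only [rels6, Set.mem_insert_iff, Set.mem_singleton_iff] at hr
    rcases hr with rfl | rfl | rfl
    · simpa [f] using hσ
    · rw [← hn]; simpa [f] using hτn
    · simpa [f] using hrel
  let φ : PresentedGroup (rels6 d) →* G := PresentedGroup.toGroup hf
  let τ' : PresentedGroup (rels6 d) := PresentedGroup.of false
  let σ' : PresentedGroup (rels6 d) := PresentedGroup.of true
  have hφτ : φ τ' = τ := PresentedGroup.toGroup.of hf
  have hφσ : φ σ' = σ := PresentedGroup.toGroup.of hf
  have hσ' : σ' ^ 3 = 1 :=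
    PresentedGroup.one_of_mem (rels := rels6 d) (x := FreeGroup.of true ^ 3) (by simp [rels6])
  have hτ' : τ' ^ n = 1 :=
    PresentedGroup.one_of_mem (rels := rels6 d) (x := FreeGroup.of false ^ n) (by simp [rels6, hn])
  have hrel' : σ'⁻¹ * τ' * σ' * τ' ^ (d - 1) = 1 :=
    PresentedGroup.one_of_mem (rels := rels6 d) (x := (FreeGroup.of true)⁻¹ * FreeGroup.of false *
      FreeGroup.of true * FreeGroup.of false ^ (d - 1)) (by simp [rels6])
  let s : Fin n × Fin 3 → PresentedGroup (rels6 d) := fun p => τ' ^ (p.1 : ℕ) * (σ' ^ (p.2 : ℕ))⁻¹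
  have hφs : ∀ p, φ (s p) = τ ^ (p.1 : ℕ) * (σ ^ (p.2 : ℕ))⁻¹ := by
    intro p
    simp [s, hφτ, hφσ]
  have hs : Function.Surjective s := by
    have key : ∀ g : PresentedGroup (rels6 d), ∃ (j : ℤ) (i : ℕ), g = τ' ^ j * (σ' ^ i)⁻¹ := by
      intro g
      have hg : g ∈ Subgroup.closure (Set.range (PresentedGroup.of (rels := rels6 d))) := by
        rw [PresentedGroup.closure_range_of]; trivial
      induction hg using Subgroup.closure_induction'' with
      | mem x hx =>
        obtain ⟨b, rfl⟩ := hx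
        cases b
        · exact ⟨1, 0, by simp [τ']⟩
        · refine ⟨0, 2, ?_⟩
          change σ' = _
          rw [zpow_zero, one_mul]
          exact eq_inv_of_mul_eq_one_left (by rw [← pow_succ', hσ'])
      | inv_mem x hx =>
        obtain ⟨b, rfl⟩ := hx
        cases b
        · exact ⟨-1, 0, by simp [τ']⟩
        · exact ⟨0, 1, by simp [σ']⟩
      | one => exact ⟨0, 0, by simp⟩
      | mul x y hx hy h1 h2 =>
        obtain ⟨j, i, rfl⟩ := h1
        obtain ⟨j', i', rfl⟩ := h2
        refine ⟨j + (-((d - 1 : ℕ) : ℤ)) ^ i * j', i' + i, ?_⟩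
        rw [_root_.zpow_add, pow_add, _root_.mul_inv_rev, mul_assoc, ← mul_assoc _ (τ' ^ j'),
          kc_swap (d - 1) τ' σ' hrel']
        simp only [mul_assoc]
    intro g
    obtain ⟨j, i, rfl⟩ := key g
    exact kc_red n hn0 τ' σ' hτ' hσ' j i
  have hsurj : Function.Surjective (φ ∘ s) := by
    intro g
    obtain ⟨i, j, h⟩ := hgen g
    obtain ⟨p, hp⟩ := kc_red n hn0 τ σ hτn hσ j i
    refine ⟨p, ?_⟩
    rw [Function.comp, hφs, hp, ← h]
    group
  have hinj : Function.Injective (φ ∘ s) := by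
    rintro ⟨a, b⟩ ⟨a', b'⟩ h
    simp only [Function.comp, hφs] at h
    have hσ2 : ∀ j : ℤ, σ ^ 2 ≠ τ ^ j := by
      intro j hj
      apply hne (j * 2)
      rw [_root_.zpow_mul, ← hj]
      have : σ = σ ^ 3 * σ := by rw [hσ, one_mul]
      conv_lhs => rw [this]
      rw [← pow_succ]
      rw [show (2 : ℤ) = ((2 : ℕ) : ℤ) from rfl, zpow_natCast, ← pow_mul]
    have h1 : τ ^ (-(a' : ℤ) + (a : ℤ)) = (σ ^ (b' : ℕ))⁻¹ * σ ^ (b : ℕ) := by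
      rw [_root_.zpow_add, _root_.zpow_neg, zpow_natCast, zpow_natCast]
      have h2 : τ ^ (a : ℕ) = τ ^ (a' : ℕ) * (σ ^ (b' : ℕ))⁻¹ * σ ^ (b : ℕ) := by
        rw [← h]; group
      rw [h2]; group
    have hs1 : σ⁻¹ = σ ^ 2 := by
      symm; exact eq_inv_of_mul_eq_one_left (by rw [← pow_succ, hσ])
    have hs2 : (σ ^ 2)⁻¹ = σ := by rw [← hs1, inv_inv]
    have hb : b = b' := by
      generalize -(a' : ℤ) + (a : ℤ) = m at h1
      have hA := hne m
      have hB := hσ2 m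
      rw [h1] at hA hB
      clear h h1
      fin_cases b <;> fin_cases b' <;>
        first
        | rfl
        | (exfalso; apply hA; simp [hs2]; done)
        | (exfalso; apply hB; simp [hs1]; done)
        | (exfalso; apply hA; simp [pow_two]; done)
        | (exfalso; apply hB; simp; rw [← hs1]; done)
        | (exfalso; apply hB; simp [pow_two]; rw [hs1, pow_two]; done)
    subst hb
    have h2 : τ ^ (a : ℕ) = τ ^ (a' : ℕ) := mul_right_cancel h
    have h3 : (a : ℕ) = a' := by
      apply pow_injOn_Iio_orderOf _ _ h2
      · simp [hτ]
      · simp [hτ]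
    rw [Fin.ext h3]
  have hφ : Function.Bijective φ := by
    refine ⟨?_, fun g => ?_⟩
    · intro x y hxy
      obtain ⟨p, rfl⟩ := hs x
      obtain ⟨q, rfl⟩ := hs y
      rw [hinj hxy]
    · obtain ⟨p, hp⟩ := hsurj g
      exact ⟨s p, hp⟩
  refine ⟨⟨(MulEquiv.ofBijective φ hφ).symm⟩, ?_⟩
  rw [← Nat.card_congr (Equiv.ofBijective (φ ∘ s) ⟨hinj, hsurj⟩)]
  simp [mul_comm]

theorem kc_abs_sub {G : Type*} [Group G] (H : Subgroup G) (d n : ℕ) (hn : n = d * d - 3 * d + 3)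
    (τ σ : G) (hτm : τ ∈ H) (hσm : σ ∈ H)
    (hσ : σ ^ 3 = 1) (hτ : orderOf τ = n) (hrel : σ⁻¹ * τ * σ * τ ^ (d - 1) = 1)
    (hne : ∀ j : ℤ, σ ≠ τ ^ j) (hgen : ∀ g ∈ H, ∃ i : ℕ, ∃ j : ℤ, g * σ ^ i = τ ^ j) :
    Nonempty (H ≃* PresentedGroup (rels6 d)) ∧ Nat.card H = 3 * n := by
  refine kc_abs d n hn (⟨τ, hτm⟩ : H) ⟨σ, hσm⟩ (Subtype.ext hσ) ?_ (Subtype.ext hrel) ?_ ?_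
  · rw [← hτ, ← Subgroup.orderOf_coe]
  · intro j h
    exact hne j (congrArg Subtype.val h)
  · rintro ⟨g, hg⟩
    obtain ⟨i, j, h⟩ := hgen g hg
    exact ⟨i, j, Subtype.ext h⟩

/-- for `d ≥ 5` and `α ≠ 0`, the automorphism group of
`X^(d-1)·Y + Y^(d-1)·Z + α·Z^(d-1)·X` is isomorphic to
`⟨τ, σ ∣ τ^(d²-3d+3) = σ³ = 1, τσ = στ^(-(d-1))⟩`; in particular it has order
`3(d²-3d+3)` and contains `τ` of order `d²-3d+3` and `σ` of order 3 with
`τσ = στ^(-(d-1))`. -/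
theorem stmt6 {K : Type*} [Field K] [IsAlgClosed K] [CharZero K]
    (d : ℕ) (hd : 5 ≤ d) (α : K) (hα : α ≠ 0)
    (F : MvPolynomial (Fin 3) K)
    (hF : F = X 0 ^ (d - 1) * X 1 + X 1 ^ (d - 1) * X 2 + C α * X 2 ^ (d - 1) * X 0) :
    Nonempty (↥(projAut F) ≃* PresentedGroup (rels6 d)) ∧
    Nat.card ↥(projAut F) = 3 * (d * d - 3 * d + 3) ∧
    ∃ τ σ : PGL3 K, τ ∈ projAut F ∧ σ ∈ projAut F ∧
      orderOf τ = d * d - 3 * d + 3 ∧ orderOf σ = 3 ∧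
      τ * σ = σ * τ ^ (-((d : ℤ) - 1)) := by
  obtain ⟨k, rfl⟩ := Nat.exists_eq_add_of_le hd
  obtain ⟨n, hn⟩ : ∃ n, n = (5 + k) * (5 + k) - 3 * (5 + k) + 3 := ⟨_, rfl⟩
  have hn0 : 0 < n := by omega
  have hnk : n + (k + 4) = (k + 4) * (k + 4) + 1 := by
    have h1 : (5 + k) * (5 + k) = k * k + 10 * k + 25 := by ring
    have h2 : (k + 4) * (k + 4) = k * k + 8 * k + 16 := by ring
    omega
  have hk1 : 5 + k - 1 = k + 4 := by omega
  obtain ⟨t0, ht0⟩ := IsAlgClosed.exists_pow_nat_eq α hn0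
  have ht00 : t0 ≠ 0 := by
    rintro rfl
    rw [zero_pow hn0.ne'] at ht0
    exact hα ht0.symm
  obtain ⟨t, rfl⟩ : ∃ t : Kˣ, (t : K) = t0 := ⟨Units.mk0 t0 ht00, rfl⟩
  have hFe : F = kcF (k + 4) ((t : K) ^ n) := by
    rw [hF, ht0, kcF, hk1]
  rw [← hn]
  subst hFe
  clear hF
  have : NeZero n := ⟨hn0.ne'⟩
  have : NeZero (n : K) := ⟨by exact_mod_cast hn0.ne'⟩
  obtain ⟨z0, hz0⟩ := HasEnoughRootsOfUnity.exists_primitiveRoot K n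
  obtain ⟨z, rfl⟩ := hz0.isUnit hn0.ne'
  have hz : IsPrimitiveRoot z n := IsPrimitiveRoot.coe_units_iff.1 hz0
  have hτmem : kcDhom K (k + 4) z ∈ projAut (kcF (k + 4) ((t : K) ^ n)) :=
    ⟨kcD (k + 4) z, kcD_mem (k + 4) n hnk _ z hz.pow_eq_one, rfl⟩
  have hσmem : (kcS (k + 4) t : PGL3 K) ∈ projAut (kcF (k + 4) ((t : K) ^ n)) :=
    ⟨kcS (k + 4) t, kcS_mem (k + 4) n (by omega) hnk t, rfl⟩
  have hτord : orderOf (kcDhom K (k + 4) z) = n := by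
    rw [orderOf_injective _ (kcDhom_inj (k + 4)), ← hz.eq_orderOf]
  have hconj : kcDhom K (k + 4) z * (kcS (k + 4) t : PGL3 K) =
      (kcS (k + 4) t : PGL3 K) * kcDhom K (k + 4) z ^ (-((k + 4 : ℕ) : ℤ)) :=
    kcS_conj (k + 4) n hnk t z hz.pow_eq_one
  have hσ3 := kcS_cube (k + 4) t
  have hσne : ∀ j : ℤ, (kcS (k + 4) t : PGL3 K) ≠ kcDhom K (k + 4) z ^ j := by
    intro j
    rw [← map_zpow]
    exact kcS_ne (k + 4) t _
  have hrel : (kcS (k + 4) t : PGL3 K)⁻¹ * kcDhom K (k + 4) z * (kcS (k + 4) t : PGL3 K) *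
      kcDhom K (k + 4) z ^ (5 + k - 1) = 1 := by
    rw [hk1, mul_assoc _ (kcDhom K (k + 4) z), hconj, _root_.zpow_neg, zpow_natCast]
    group
  have hgen : ∀ g ∈ projAut (kcF (k + 4) ((t : K) ^ n)),
      ∃ i : ℕ, ∃ j : ℤ, g * (kcS (k + 4) t : PGL3 K) ^ i = kcDhom K (k + 4) z ^ j := by
    rintro g ⟨A, hA, rfl⟩
    obtain ⟨i, w, hw, h⟩ := kc_classify k n hnk t A hA
    obtain ⟨j, -, hj⟩ := hz0.eq_pow_of_pow_eq_one
      (show (w : K) ^ n = 1 by rw [← Units.val_pow_eq_pow_val, hw, Units.val_one])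
    have hj' : z ^ j = w := Units.ext (by simpa using hj)
    refine ⟨i, j, ?_⟩
    rw [← hj', map_pow] at h
    rw [zpow_natCast]
    exact h
  have hab := kc_abs_sub _ (5 + k) n hn _ _ hτmem hσmem hσ3 hτord hrel hσne hgen
  refine ⟨hab.1, hab.2, kcDhom K (k + 4) z, (kcS (k + 4) t : PGL3 K), hτmem, hσmem, hτord, ?_, ?_⟩
  · have : Fact (Nat.Prime 3) := ⟨Nat.prime_three⟩
    exact orderOf_eq_prime hσ3 (by simpa using hσne 0)
  · have : ((5 + k : ℕ) : ℤ) - 1 = ((k + 4 : ℕ) : ℤ) := by push_cast; ring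
    rw [this]
    exact hconj

end
end

section
/- Let K be an algebraically closed field of characteristic 0, let d ≥ 5, and let F ∈ K[X,Y,Z] be a nonsingular homogeneous polynomial of degree d. If Aut(F) contains an element of order ℓ(d−1) for some integer ℓ with 2 ≤ ℓ ≤ d, then ℓ divides d or ℓ divides d−1. -/
open MvPolynomial Matrix

noncomputable section

variable {K : Type*} [Field K]

section arith
variable {M : Type*} [AddCommGroup M]

/-- `n` divides every integer killing all differences of `p, q, r`. -/
def KillDvd (n : ℤ) (p q r : M) : Prop := ∀ k : ℤ, k • p = k • q → k • q = k • r → n ∣ k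

/-- Good conclusion. -/
def Good (D l : ℤ) : Prop := l ∣ D + 1 ∨ l ∣ D

variable {D l : ℤ} {p q r w : M}

lemma case1 (h : KillDvd (l * D) p q r)
    (hp : D • p + p = w) (hq : D • q + q = w) (hr : D • r + r = w) : Good D l := by
  left
  refine (Dvd.intro _ rfl).trans (h (D + 1) ?_ ?_)
  · linear_combination (norm := module) hp - hq
  · linear_combination (norm := module) hq - hr

lemma case2 (hD : 4 ≤ D) (h : KillDvd (l * D) p q r)
    (hp : D • p + p = w) (hq : D • q + q = w) (hr : D • r + p = w) : Good D l := by
  left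
  have := h ((D + 1) * D) ?_ ?_
  · exact Int.dvd_of_mul_dvd_mul_right (by omega) this
  · linear_combination (norm := module) D • hp - D • hq
  · linear_combination (norm := module) D • hq - (D + 1) • hr + hp

lemma case3a (h : KillDvd (l * D) p q r)
    (hp : D • p + p = w) (hq : D • q + p = w) (hr : D • r + p = w) : Good D l := by
  right
  refine (Dvd.intro _ rfl).trans (h D ?_ ?_)
  · linear_combination (norm := module) hp - hq
  · linear_combination (norm := module) hq - hr

lemma case3b (hD : 4 ≤ D) (h : KillDvd (l * D) p q r)
    (hp : D • p + p = w) (hq : D • q + p = w) (hr : D • r + q = w) : Good D l := by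
  right
  have := h (D * D) ?_ ?_
  · exact Int.dvd_of_mul_dvd_mul_right (by omega) this
  · linear_combination (norm := module) D • hp - D • hq
  · linear_combination (norm := module) (D+1) • hq - D • hr - hp

lemma no_dvd (hD : 4 ≤ D) {k a : ℤ} (h : l * D ∣ k) (e : k = D * a + 1 ∨ k = D * a - 1) : False := by
  have h1 : D ∣ k := (Dvd.intro_left _ rfl).trans h
  have : D ∣ 1 := by
    rcases e with rfl | rfl
    · exact (Int.dvd_add_right (Dvd.intro _ rfl)).1 h1
    · simpa using (dvd_sub (Dvd.intro a rfl) h1)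
  have := Int.le_of_dvd one_pos this
  omega

lemma case3c (hD : 4 ≤ D) (h : KillDvd (l * D) p q r)
    (hp : D • p + p = w) (hq : D • q + r = w) (hr : D • r + q = w) : Good D l := by
  exfalso
  refine no_dvd hD (h (D * D - 1) ?_ ?_) (a := D) (Or.inr rfl)
  · linear_combination (norm := module) (D-1) • hp - D • hq + hr
  · linear_combination (norm := module) (D+1) • hq - (D+1) • hr

lemma case4a (hD : 4 ≤ D) (h : KillDvd (l * D) p q r)
    (hp : D • p + q = w) (hq : D • q + r = w) (hr : D • r + p = w) : Good D l := by
  exfalso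
  refine no_dvd hD (h (D * D - D + 1) ?_ ?_) (a := D - 1) (Or.inl (by ring))
  · linear_combination (norm := module) (D-1) • hp - D • hq + hr
  · linear_combination (norm := module) (D-1) • hq - D • hr + hp

lemma case4b (hD : 4 ≤ D) (hl : 2 ≤ l) (h : KillDvd (l * D) p q r)
    (hp : D • p + q = w) (hq : D • q + p = w) (hr : D • r + p = w)
    (b : ℤ) (hb : b • q + (D + 1 - b) • r = w) : Good D l := by
  exfalso
  have h1 := h (D * (D - 1)) ?_ ?_
  · have h1 : l ∣ D - 1 := Int.dvd_of_mul_dvd_mul_right (a := D) (by omega) (by rwa [mul_comm (D-1)])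
    have h2 := h ((D - 1) * b + 1) ?_ ?_
    · have h2 := (Dvd.intro _ rfl).trans h2
      have h3 : l ∣ 1 := (Int.dvd_add_right (h1.mul_right _)).1 h2
      have := Int.le_of_dvd one_pos h3
      omega
    · linear_combination (norm := module) (-((D - 1) * b + 1)) • (hp - hr) - D • (hb - hr + b • (hr - hp))
    · linear_combination (norm := module) ((D - 1) * b + 1) • (hp - hr) + (D - 1) • (hb - hr + b • (hr - hp))
  · linear_combination (norm := module) D • hp - D • hq
  · linear_combination (norm := module) (D-1) • hq - (D-1) • hr

lemma classify : ∀ f : Fin 3 → Fin 3, ∃ i j k : Fin 3, i ≠ j ∧ j ≠ k ∧ i ≠ k ∧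
    ((f i = i ∧ f j = j ∧ f k = k) ∨ (f i = i ∧ f j = j ∧ f k = i) ∨
     (f i = i ∧ f j = i ∧ f k = i) ∨ (f i = i ∧ f j = i ∧ f k = j) ∨
     (f i = i ∧ f j = k ∧ f k = j) ∨ (f i = j ∧ f j = k ∧ f k = i) ∨
     (f i = j ∧ f j = i ∧ f k = i)) := by decide

lemma arith_main (hD : 4 ≤ D) (hl : 2 ≤ l) (e : Fin 3 → M)
    (h : ∀ i j k : Fin 3, i ≠ j → j ≠ k → i ≠ k → KillDvd (l * D) (e i) (e j) (e k))
    (f : Fin 3 → Fin 3) (hf : ∀ i, D • e i + e (f i) = w)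
    (hz : ∀ i j k : Fin 3, i ≠ j → j ≠ k → i ≠ k →
      ∃ b : ℤ, b • e j + (D + 1 - b) • e k = w) : Good D l := by
  obtain ⟨i, j, k, hij, hjk, hik, hc⟩ := classify f
  have h := h i j k hij hjk hik
  obtain ⟨b, hb⟩ := hz i j k hij hjk hik
  have hi := hf i
  have hj := hf j
  have hk := hf k
  rcases hc with ⟨h1, h2, h3⟩ | ⟨h1, h2, h3⟩ | ⟨h1, h2, h3⟩ | ⟨h1, h2, h3⟩ | ⟨h1, h2, h3⟩ |
    ⟨h1, h2, h3⟩ | ⟨h1, h2, h3⟩ <;> rw [h1] at hi <;> rw [h2] at hj <;> rw [h3] at hk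
  · exact case1 h hi hj hk
  · exact case2 hD h hi hj hk
  · exact case3a h hi hj hk
  · exact case3b hD h hi hj hk
  · exact case3c hD h hi hj hk
  · exact case4a hD h hi hj hk
  · exact case4b hD hl h hi hj hk b hb

end arith

section poly

lemma eval_smul_hom {G : MvPolynomial (Fin 3) K} {n : ℕ} (hG : G.IsHomogeneous n) (c : K)
    (x : Fin 3 → K) : eval (fun i => c * x i) G = c ^ n * eval x G := by
  rw [eval_eq', eval_eq', Finset.mul_sum]
  refine Finset.sum_congr rfl fun m hm => ?_
  have h1 : m.degree = n := by
    by_contra hne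
    exact (mem_support_iff.1 hm) (hG.coeff_eq_zero hne)
  simp only [mul_pow, Finset.prod_mul_distrib, Finset.prod_pow_eq_pow_sum]
  rw [← h1, Finsupp.degree_eq_sum]
  ring

lemma eval_basis {G : MvPolynomial (Fin 3) K} {n : ℕ} (hG : G.IsHomogeneous n) (i : Fin 3) :
    eval (Pi.single i 1) G = coeff (Finsupp.single i n) G := by
  rw [eval_eq']
  rw [Finset.sum_eq_single (Finsupp.single i n)]
  · rw [Finset.prod_eq_one, mul_one]
    intro j _
    by_cases hj : j = i
    · subst hj; simp
    · simp [Finsupp.single_apply, Ne.symm hj]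
  · intro m hm hne
    have h1 : m.degree = n := by
      by_contra hne
      exact (mem_support_iff.1 hm) (hG.coeff_eq_zero hne)
    obtain ⟨j, hj, hmj⟩ : ∃ j, j ≠ i ∧ m j ≠ 0 := by
      by_contra hcon
      push Not at hcon
      apply hne
      have h2 : m = Finsupp.single i (m i) := by
        ext j
        by_cases hj : j = i
        · subst hj; simp
        · simp [Finsupp.single_apply, Ne.symm hj, hcon j hj]
      rw [h2] at h1
      rw [Finsupp.degree_single] at h1
      rw [h2, h1]
    rw [Finset.prod_eq_zero (Finset.mem_univ j), mul_zero]
    simp [hj, hmj]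
  · intro h
    rw [notMem_support_iff.1 h, zero_mul]

lemma exists_mono {F : MvPolynomial (Fin 3) K} {d : ℕ}
    (hhom : F.IsHomogeneous d) (hns : IsNonsingular F) (i : Fin 3) :
    ∃ j, coeff (Finsupp.single i (d - 1) + Finsupp.single j 1) F ≠ 0 := by
  by_contra hcon
  push Not at hcon
  have := hns (Pi.single i 1) fun j => by
    rw [eval_basis hhom.pderiv, coeff_pderiv, hcon, zero_mul]
  have := congrFun this i
  simp at this

lemma root_two [IsAlgClosed K] [CharZero K] {G : MvPolynomial (Fin 3) K} {n : ℕ} (hn : n ≠ 0)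
    (hG : G.IsHomogeneous n) (i : Fin 3) : ∃ x : Fin 3 → K, x ≠ 0 ∧ x i = 0 ∧ eval x G = 0 := by
  obtain ⟨j, k, hij, hjk, hik⟩ : ∃ j k : Fin 3, i ≠ j ∧ j ≠ k ∧ i ≠ k := by
    revert i; decide
  let pt : K → K → Fin 3 → K := fun s t l => if l = j then s else if l = k then t else 0
  have e1 : ∀ s t, pt s t j = s := by intro s t; simp [pt]
  have e2 : ∀ s t, pt s t k = t := by intro s t; simp [pt, hjk.symm]
  have e3 : ∀ s t, pt s t i = 0 := by intro s t; simp [pt, hij, hik]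
  have key : ∀ u v : Polynomial K, ∃ p : Polynomial K,
      ∀ s, p.eval s = eval (pt (u.eval s) (v.eval s)) G := by
    intro u v
    refine ⟨aeval (fun l => if l = j then u else if l = k then v else 0) G, fun s => ?_⟩
    rw [← Polynomial.coe_evalRingHom, MvPolynomial.aeval_def, MvPolynomial.hom_eval₂]
    rw [MvPolynomial.eval, MvPolynomial.coe_eval₂Hom]
    congr 1
    · ext; simp
    · funext l
      simp only [pt, Function.comp]
      split_ifs <;> simp
  obtain ⟨p, hp⟩ := key Polynomial.X 1
  obtain ⟨q, hq⟩ := key 1 Polynomial.X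
  simp only [Polynomial.eval_X, Polynomial.eval_one] at hp hq
  by_cases hpd : p.degree = 0
  · by_cases hqd : q.degree = 0
    · exfalso
      rw [Polynomial.eq_C_of_degree_eq_zero hpd] at hp
      rw [Polynomial.eq_C_of_degree_eq_zero hqd] at hq
      simp only [Polynomial.eval_C] at hp hq
      have h1 := (hp 1).trans (hq 1).symm
      have h2 : eval (pt 2 1) G = 2 ^ n * eval (pt 1 (2⁻¹)) G := by
        rw [← eval_smul_hom hG]
        congr 2
        funext l
        simp only [pt]
        split_ifs <;> simp
      rw [← hp, ← hq, ← h1] at h2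
      have h3 : p.coeff 0 ≠ 0 := by
        intro h0
        rw [Polynomial.eq_C_of_degree_eq_zero hpd, h0] at hpd
        simp at hpd
      have h4 : (2 : K) ^ n = 1 := by
        apply mul_right_cancel₀ h3
        rw [← h2, one_mul]
      have h5 : 2 ^ n = 1 := by exact_mod_cast h4
      have := Nat.one_lt_two_pow hn
      omega
    · obtain ⟨s, hs⟩ := IsAlgClosed.exists_root q hqd
      refine ⟨pt 1 s, fun h0 => ?_, e3 _ _, by rw [← hq]; exact hs⟩
      have := congrFun h0 j
      rw [e1] at this
      simp at this
  · obtain ⟨s, hs⟩ := IsAlgClosed.exists_root p hpd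
    refine ⟨pt s 1, fun h0 => ?_, e3 _ _, by rw [← hp]; exact hs⟩
    have := congrFun h0 k
    rw [e2] at this
    simp at this

lemma exists_zero_exp [IsAlgClosed K] [CharZero K] {F : MvPolynomial (Fin 3) K} {d : ℕ}
    (hd : 2 ≤ d) (hhom : F.IsHomogeneous d) (hns : IsNonsingular F) (i : Fin 3) :
    ∃ m, coeff m F ≠ 0 ∧ m i = 0 := by
  by_contra hcon
  push Not at hcon
  obtain ⟨x, hx0, hxi, hx⟩ := root_two (n := d - 1) (by omega) (hhom.pderiv (i := i)) i
  refine hx0 (hns x fun j => ?_)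
  by_cases hj : j = i
  · subst hj; exact hx
  · rw [eval_eq']
    refine Finset.sum_eq_zero fun m hm => ?_
    rw [mem_support_iff, coeff_pderiv] at hm
    have := hcon _ (left_ne_zero_of_mul hm)
    rw [Finsupp.add_apply, Finsupp.single_apply, if_neg hj, add_zero] at this
    rw [Finset.prod_eq_zero (Finset.mem_univ i), mul_zero]
    rw [hxi, zero_pow this]

lemma nonsing_subst {F : MvPolynomial (Fin 3) K} (hns : IsNonsingular F)
    (A : Matrix (Fin 3) (Fin 3) K) (hA : IsUnit A) : IsNonsingular (substPoly A F) := by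
  intro x hx
  have h1 : Aᵀ *ᵥ (fun j => eval (A *ᵥ x) (pderiv j F)) = 0 := by
    funext i
    have := hx i
    rw [pderiv_substPoly] at this
    simpa [eval_substPoly, Matrix.mulVec, dotProduct] using this
  have h2 : (fun j => eval (A *ᵥ x) (pderiv j F)) = 0 := by
    apply Matrix.mulVec_injective_of_isUnit ((Matrix.isUnit_transpose A).2 hA)
    simpa using h1
  have h3 := hns _ (congrFun h2)
  apply Matrix.mulVec_injective_of_isUnit hA
  simpa using h3

lemma hom_subst {F : MvPolynomial (Fin 3) K} {d : ℕ} (hF : F.IsHomogeneous d)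
    (A : Matrix (Fin 3) (Fin 3) K) : (substPoly A F).IsHomogeneous d := by
  unfold substPoly
  have := hF.aeval (fun i => ∑ j, A i j • (X j : MvPolynomial (Fin 3) K)) (n := 1) fun i => by
    refine IsHomogeneous.sum _ _ _ fun j _ => ?_
    rw [smul_eq_C_mul]
    exact isHomogeneous_C_mul_X _ _
  simpa using this

lemma coeff_diag (μ : Fin 3 → K) (F : MvPolynomial (Fin 3) K) (m : Fin 3 →₀ ℕ) :
    coeff m (substPoly (Matrix.diagonal μ) F) = (∏ i, μ i ^ m i) * coeff m F := by
  unfold substPoly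
  have hf : (fun i => ∑ j, Matrix.diagonal μ i j • (X j : MvPolynomial (Fin 3) K))
      = fun i => C (μ i) * X i := by
    funext i
    simp [Matrix.diagonal_apply, ite_smul, smul_eq_C_mul]
  rw [hf]
  induction F using MvPolynomial.induction_on' with
  | add p q hp hq => simp only [map_add, coeff_add, hp, hq, mul_add]
  | monomial u a =>
    rw [aeval_monomial, Finsupp.prod_fintype _ _ (by simp)]
    simp only [mul_pow, Finset.prod_mul_distrib, ← C_pow]
    rw [← map_prod]
    have : (∏ i, (X i : MvPolynomial (Fin 3) K) ^ u i) = monomial u 1 := by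
      rw [monomial_eq, Finsupp.prod_fintype _ _ (by simp)]; simp
    rw [this, algebraMap_eq, C_mul_monomial, C_mul_monomial, coeff_monomial, coeff_monomial]
    split_ifs with h
    · subst h; ring
    · simp

lemma exists_diag_s8 [IsAlgClosed K] [CharZero K] (A : Matrix (Fin 3) (Fin 3) K) (n : ℕ) (hn : n ≠ 0)
    (c : K) (hc : c ≠ 0) (hA : A ^ n = Matrix.scalar (Fin 3) c) :
    ∃ (P : Matrix (Fin 3) (Fin 3) K) (μ : Fin 3 → K), IsUnit P ∧ A * P = P * Matrix.diagonal μ := by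
  let f : Module.End K (Fin 3 → K) := Matrix.toLin' A
  have hss : f.IsSemisimple := by
    refine Module.End.isSemisimple_of_squarefree_aeval_eq_zero
      (p := Polynomial.X ^ n - Polynomial.C c) ?_ ?_
    · exact (Polynomial.separable_X_pow_sub_C c (by exact_mod_cast hn) hc).squarefree
    · rw [map_sub, map_pow, Polynomial.aeval_X, Polynomial.aeval_C]
      have : f ^ n = Matrix.toLin' (A ^ n) := (Matrix.toLin'_pow A n).symm
      rw [this, hA, sub_eq_zero]
      ext x
      simp [Matrix.toLin'_apply, Module.algebraMap_end_apply, Pi.single_apply]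
  let s : Set (Fin 3 → K) := {v | ∃ a : K, f v = a • v}
  have hs : ⊤ ≤ Submodule.span K s := by
    rw [← hss.iSup_eigenspace_eq_top]
    refine iSup_le fun a v hv => Submodule.subset_span ⟨a, ?_⟩
    exact Module.End.mem_eigenspace_iff.1 hv
  let b0 := Module.Basis.ofSpan hs
  have : Fintype ((linearIndepOn_empty K id).extend (Set.empty_subset s)) :=
    FiniteDimensional.fintypeBasisIndex b0
  have hcard : Fintype.card ((linearIndepOn_empty K id).extend (Set.empty_subset s)) = 3 := by
    rw [← Module.finrank_eq_card_basis b0]; simp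
  let b := b0.reindex (Fintype.equivFinOfCardEq hcard)
  have hb : ∀ i, ∃ a : K, f (b i) = a • b i := by
    intro i
    apply Module.Basis.ofSpan_subset hs
    simp [b, b0]
  choose μ hμ using hb
  refine ⟨Matrix.of fun i j => b j i, μ, ?_, ?_⟩
  · have : (Matrix.of fun i j => b j i) = (Pi.basisFun K (Fin 3)).toMatrix b := by
      ext i j
      simp [Module.Basis.toMatrix_apply]
    rw [this]
    exact IsUnit.of_mul_eq_one _ (Module.Basis.toMatrix_mul_toMatrix_flip _ _)
  · ext i j
    rw [Matrix.mul_diagonal]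
    have := congrFun (hμ j) i
    simp only [f, Matrix.toLin'_apply, Matrix.mulVec, dotProduct, Pi.smul_apply,
      smul_eq_mul] at this
    simp only [Matrix.mul_apply, Matrix.of_apply, this, mul_comm]

end poly

/-- if a nonsingular plane curve of degree `d ≥ 5` has an automorphism of
order `ℓ(d-1)` with `2 ≤ ℓ ≤ d`, then `ℓ ∣ d` or `ℓ ∣ d-1`. -/
theorem stmt8 {K : Type*} [Field K] [IsAlgClosed K] [CharZero K]
    (d : ℕ) (hd : 5 ≤ d) (F : MvPolynomial (Fin 3) K)
    (hhom : F.IsHomogeneous d) (hns : IsNonsingular F)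
    (ℓ : ℕ) (hℓ1 : 2 ≤ ℓ) (hℓ2 : ℓ ≤ d)
    (h : ∃ g ∈ projAut F, orderOf g = ℓ * (d - 1)) :
    ℓ ∣ d ∨ ℓ ∣ d - 1 := by
  classical
  obtain ⟨g, ⟨A, ⟨c, hc⟩, rfl⟩, hord⟩ := h
  set n := ℓ * (d - 1) with hn
  have hn0 : n ≠ 0 := Nat.mul_ne_zero (by omega) (by omega)
  have hcen : A ^ n ∈ Subgroup.center (GL (Fin 3) K) := by
    have h1 := pow_orderOf_eq_one (QuotientGroup.mk' (Subgroup.center (GL (Fin 3) K)) A)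
    rw [hord, ← map_pow] at h1
    exact (QuotientGroup.eq_one_iff _).1 h1
  obtain ⟨c', hc'⟩ := Matrix.GeneralLinearGroup.mem_center_iff_val_mem_range_scalar.1 hcen
  have hc'0 : c' ≠ 0 := by
    rintro rfl
    rw [map_zero] at hc'
    exact Units.ne_zero (A ^ n) hc'.symm
  obtain ⟨P, μ, hP, hAP⟩ := exists_diag_s8 (A : Matrix (Fin 3) (Fin 3) K) n hn0 c' hc'0
    (by rw [hc', Units.val_pow_eq_pow_val])
  have hμu : IsUnit μ := by
    rw [← Matrix.isUnit_diagonal]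
    have h1 : IsUnit (P * Matrix.diagonal μ) := by
      rw [← hAP]; exact A.isUnit.mul hP
    have h2 := hP.unit.isUnit_units_mul (Matrix.diagonal μ)
    rw [IsUnit.unit_spec] at h2
    exact h2.1 h1
  have hμ : ∀ i, μ i ≠ 0 := fun i => (Pi.isUnit_iff.1 hμu i).ne_zero
  set F' := substPoly P F with hF'
  have hhom' : F'.IsHomogeneous d := hom_subst hhom P
  have hns' : IsNonsingular F' := nonsing_subst hns P hP
  have hinv : substPoly (Matrix.diagonal μ) F' = (c : K) • F' := by
    rw [hF', ← substPoly_mul, ← hAP, substPoly_mul, hc, substPoly_smul]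
  let e : Fin 3 → Additive Kˣ := fun i => Additive.ofMul (Units.mk0 (μ i) (hμ i))
  let w : Additive Kˣ := Additive.ofMul c
  have hw : ∀ m : Fin 3 →₀ ℕ, coeff m F' ≠ 0 → ∑ i, m i • e i = w := by
    intro m hm
    have h1 := coeff_diag μ F' m
    rw [hinv, coeff_smul, smul_eq_mul] at h1
    have h2 := mul_right_cancel₀ hm h1
    apply Additive.toMul.injective
    ext
    simp [e, w, h2]
  have hkill : ∀ k : ℤ, (∀ i j, k • e i = k • e j) → ((ℓ : ℤ) * ((d : ℤ) - 1)) ∣ k := by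
    intro k hk
    have hk' : ∀ i j, k.natAbs • e i = k.natAbs • e j := by
      intro i j
      have h1 := hk i j
      rcases Int.natAbs_eq k with h2 | h2
      · rw [h2, natCast_zsmul, natCast_zsmul] at h1
        exact h1
      · rw [h2, neg_zsmul, neg_zsmul, natCast_zsmul, natCast_zsmul] at h1
        exact neg_injective h1
    have hk2 : ∀ i j, μ i ^ k.natAbs = μ j ^ k.natAbs := by
      intro i j
      have := congrArg (fun x => ((Additive.toMul x : Kˣ) : K)) (hk' i j)
      simpa [e] using this
    have hpow : ∀ t : ℕ, (A : Matrix (Fin 3) (Fin 3) K) ^ t * P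
        = P * Matrix.diagonal (fun i => μ i ^ t) := by
      intro t
      induction t with
      | zero => simp
      | succ t ih =>
        rw [pow_succ, mul_assoc, hAP, ← mul_assoc, ih, mul_assoc, Matrix.diagonal_mul_diagonal]
        simp only [pow_succ]
    have hsc : (A : Matrix (Fin 3) (Fin 3) K) ^ k.natAbs
        = Matrix.scalar (Fin 3) (μ 0 ^ k.natAbs) := by
      apply hP.mul_right_cancel
      rw [hpow]
      have h1 : Matrix.diagonal (fun i => μ i ^ k.natAbs)
          = Matrix.scalar (Fin 3) (μ 0 ^ k.natAbs) := by
        rw [Matrix.scalar_apply]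
        congr 1
        funext i
        exact hk2 i 0
      rw [h1]
      exact ((Matrix.scalar_commute _ (fun _ => Commute.all _ _) P).eq).symm
    have hcen2 : A ^ k.natAbs ∈ Subgroup.center (GL (Fin 3) K) :=
      Matrix.GeneralLinearGroup.mem_center_iff_val_mem_range_scalar.2
        ⟨_, by rw [Units.val_pow_eq_pow_val, hsc]⟩
    have h3 : orderOf (QuotientGroup.mk' (Subgroup.center (GL (Fin 3) K)) A) ∣ k.natAbs := by
      rw [orderOf_dvd_iff_pow_eq_one, ← map_pow]
      exact (QuotientGroup.eq_one_iff _).2 hcen2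
    rw [hord, hn] at h3
    have h4 := Int.natCast_dvd.2 h3
    rwa [Nat.cast_mul, Nat.cast_sub (by omega), Nat.cast_one] at h4
  have hcov : ∀ i j k l : Fin 3, i ≠ j → j ≠ k → i ≠ k → l = i ∨ l = j ∨ l = k := by decide
  choose f hf using exists_mono hhom' hns'
  have hgood : Good ((d : ℤ) - 1) ℓ := by
    refine arith_main (w := w) (by omega) (by omega) e ?_ f ?_ ?_
    · intro i j k hij hjk hik t h1 h2
      apply hkill
      have h3 : ∀ l, t • e l = t • e i := by
        intro l
        rcases hcov i j k l hij hjk hik with rfl | rfl | rfl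
        · rfl
        · exact h1.symm
        · rw [h1, h2]
      intro a b
      rw [h3 a, h3 b]
    · intro i
      have h1 := hw _ (hf i)
      simp only [Finsupp.add_apply, add_smul, Finset.sum_add_distrib, Finsupp.single_apply,
        ite_smul, zero_smul, one_smul, Finset.sum_ite_eq, Finset.mem_univ, if_true] at h1
      rw [← h1, ← natCast_zsmul, Nat.cast_sub (by omega), Nat.cast_one]
    · intro i j k hij hjk hik
      obtain ⟨m, hm, hmi⟩ := exists_zero_exp (by omega) hhom' hns' i
      have hdeg : m.degree = d := by
        by_contra hne
        exact hm (hhom'.coeff_eq_zero hne)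
      have huniv : (Finset.univ : Finset (Fin 3)) = {i, j, k} := by
        ext l
        simpa using hcov i j k l hij hjk hik
      have hsum : ∀ {N : Type _} [AddCommMonoid N] (G : Fin 3 → N),
          ∑ l, G l = G i + (G j + G k) := by
        intro N _ G
        rw [huniv, Finset.sum_insert (by simp [hij, hik]), Finset.sum_insert (by simp [hjk]),
          Finset.sum_singleton]
      rw [Finsupp.degree_eq_sum, huniv, Finset.sum_insert (by simp [hij, hik]),
        Finset.sum_insert (by simp [hjk]), Finset.sum_singleton, hmi] at hdeg
      have h1 := hw m hm
      rw [hsum, hmi, zero_smul, zero_add] at h1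
      refine ⟨m j, ?_⟩
      have h2 : (d : ℤ) - 1 + 1 - m j = m k := by omega
      rw [h2, natCast_zsmul, natCast_zsmul, h1]
  rcases hgood with h1 | h1
  · left
    rw [sub_add_cancel] at h1
    exact_mod_cast h1
  · right
    rw [← Nat.cast_one, ← Nat.cast_sub (by omega)] at h1
    exact_mod_cast h1

end
end
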